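/- Let κ be an infinite cardinal. For every ordinal α < κ⁺, the class 𝒯_α of rooted trees of size at most κ whose Nash-Williams rank equals α has at most κ equivalence classes under ≡, i.e. |𝒯_α|_≡ ≤ κ. -/

import Mathlib

universe u v

/-- A topological minor embedding of `H` into `G`: an injective map `toFun` on vertices
together with, for each edge of `H`, a path in `G` joining the images of its endpoints,
such that distinct edges get internally vertex-disjoint paths whose internal vertices
avoid the image of `toFun`. -/
structure TopMinorEmb {V : Type u} {W : Type v} (H : SimpleGraph V) (G : SimpleGraph W) where
  toFun : V → W
  inj : Function.Injective toFun
  path : ∀ ⦃a b : V⦄, H.Adj a b → G.Walk (toFun a) (toFun b)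
  path_isPath : ∀ ⦃a b : V⦄ (h : H.Adj a b), (path h).IsPath
  path_symm : ∀ ⦃a b : V⦄ (h : H.Adj a b), path h.symm = (path h).reverse
  internal_avoid_image : ∀ ⦃a b : V⦄ (h : H.Adj a b) (w : W),
      w ∈ (path h).support → w ≠ toFun a → w ≠ toFun b → ∀ x : V, toFun x ≠ w
  internally_disjoint : ∀ ⦃a b a' b' : V⦄ (h : H.Adj a b) (h' : H.Adj a' b'),
      s(a, b) ≠ s(a', b') → ∀ w : W,
        w ∈ (path h).support → w ∈ (path h').support → w = toFun a ∨ w = toFun b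

/-- `H ≤ G`: some subdivision of `H` embeds as a subgraph into `G`. -/
def TopMinorLE {V : Type u} {W : Type v} (H : SimpleGraph V) (G : SimpleGraph W) : Prop :=
  Nonempty (TopMinorEmb H G)

/-- `G ≡ H`: `G` and `H` have the same topological type. -/
def TopEquiv {V : Type u} {W : Type v} (G : SimpleGraph V) (H : SimpleGraph W) : Prop :=
  TopMinorLE G H ∧ TopMinorLE H G

/-- A rooted graph: a simple graph together with a distinguished root vertex. -/
structure RootedGraph (V : Type u) where
  graph : SimpleGraph V
  root : V

/-- `treeLE G r t s` : the tree-order `t ≤_r s`, i.e. `t` lies on the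
(for trees unique) path in `G` from the root `r` to `s`. -/
def treeLE {V : Type u} (G : SimpleGraph V) (r t s : V) : Prop :=
  ∃ w : G.Walk r s, w.IsPath ∧ t ∈ w.support

/-- `T ≤ S` for rooted graphs: a topological minor embedding of the underlying graphs
that preserves the tree-orders. -/
def RootedLE {V : Type u} {W : Type v} (T : RootedGraph V) (S : RootedGraph W) : Prop :=
  ∃ e : TopMinorEmb T.graph S.graph,
    ∀ x y : V, treeLE T.graph T.root x y → treeLE S.graph S.root (e.toFun x) (e.toFun y)

/-- `T ≡ S` : rooted graphs of the same topological type. -/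
def RootedEquiv {V : Type u} {W : Type v} (T : RootedGraph V) (S : RootedGraph W) : Prop :=
  RootedLE T S ∧ RootedLE S T

/-- The up-closure `{t' : t ≤_r t'}` of `t` (the `insert` is redundant for
connected graphs such as trees). -/
def upSet {V : Type u} (T : RootedGraph V) (t : V) : Set V :=
  insert t {s | treeLE T.graph T.root t s}

/-- The rooted subtree `⌈t⌉`: the subgraph induced on the up-closure of `t`, rooted at `t`. -/
def subtreeAt {V : Type u} (T : RootedGraph V) (t : V) : RootedGraph (upSet T t) :=
  ⟨T.graph.induce (upSet T t), ⟨t, Set.mem_insert t _⟩⟩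

/-- Rooted graphs bundled with their vertex type. -/
def RTreeSig := Σ V : Type u, RootedGraph V

def RTle (T S : RTreeSig.{u}) : Prop := RootedLE T.2 S.2

def RTequiv (T S : RTreeSig.{u}) : Prop := RTle T S ∧ RTle S T

def subtreeSig (T : RTreeSig.{u}) (t : T.1) : RTreeSig.{u} := ⟨upSet T.2 t, subtreeAt T.2 t⟩

/-- `HasNWRankAux α T` : the rooted tree `T` has Nash-Williams rank `α`:
`T` has rank `0` iff `⌈t⌉ ≡ T` for all vertices `t`, and for `α > 0`, `T` has rank `α`
iff it has no rank `< α` and for every vertex `t` either `⌈t⌉ ≡ T` or `⌈t⌉` has some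
rank `< α`.  (For `α = 0` the clause below reduces to the former, as no ordinal is `< 0`.) -/
def HasNWRankAux : Ordinal.{u} → RTreeSig.{u} → Prop :=
  WellFounded.fix Ordinal.lt_wf fun α ih p =>
    (∀ β (hβ : β < α), ¬ ih β hβ p) ∧
    ∀ t : p.1, RTequiv (subtreeSig p t) p ∨ ∃ β, ∃ hβ : β < α, ih β hβ (subtreeSig p t)

namespace NashWilliams

open Set

/-! ### Arrays on infinite sets of natural numbers -/

/-- `Y` is an infinite subset of `A`. -/
def InfSub (A Y : Set ℕ) : Prop := Y ⊆ A ∧ Y.Infinite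

/-- The set `Y` without its least element. -/
noncomputable def shift (Y : Set ℕ) : Set ℕ := Y \ {sInf Y}

/-- `f` is locally constant on the infinite subsets of `A`. -/
def LocConst {Q : Type*} (A : Set ℕ) (f : Set ℕ → Q) : Prop :=
  ∀ Y, InfSub A Y → ∃ n, ∀ Z, InfSub A Z → Z ∩ Iio n = Y ∩ Iio n → f Z = f Y

/-- `f` is a bad array on `A` for the relation `le`. -/
def Bad {Q : Type*} (le : Q → Q → Prop) (A : Set ℕ) (f : Set ℕ → Q) : Prop :=
  ∀ Y, InfSub A Y → ¬ le (f Y) (f (shift Y))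

/-- Every sequence in `S` has a good pair. -/
def WQO {Q : Type*} (r : Q → Q → Prop) (S : Set Q) : Prop :=
  ∀ s : ℕ → Q, (∀ i, s i ∈ S) → ∃ i j, i < j ∧ r (s i) (s j)

/-- There is no bad array with values in `S`. -/
def BQO {Q : Type*} (r : Q → Q → Prop) (S : Set Q) : Prop :=
  ∀ A : Set ℕ, A.Infinite → ∀ f : Set ℕ → Q, LocConst A f → (∀ Y, InfSub A Y → f Y ∈ S) →
    ¬ Bad r A f

theorem shift_subset (Y : Set ℕ) : shift Y ⊆ Y := sdiff_subset

theorem InfSub.mono {A B Y : Set ℕ} (h : InfSub B Y) (hBA : B ⊆ A) : InfSub A Y :=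
  ⟨h.1.trans hBA, h.2⟩

theorem InfSub.shift {A Y : Set ℕ} (h : InfSub A Y) : InfSub A (shift Y) :=
  ⟨sdiff_subset.trans h.1, h.2.sdiff (finite_singleton _)⟩

theorem InfSub.refl {A : Set ℕ} (h : A.Infinite) : InfSub A A := ⟨Subset.rfl, h⟩

theorem inter_Iio_of_le {A B : Set ℕ} {m n : ℕ} (h : m ≤ n) (e : A ∩ Iio n = B ∩ Iio n) :
    A ∩ Iio m = B ∩ Iio m := by
  ext x
  have := Set.ext_iff.1 e x
  simp only [mem_inter_iff, mem_Iio] at this ⊢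
  constructor
  · rintro ⟨h1, h2⟩; exact ⟨(this.1 ⟨h1, by omega⟩).1, h2⟩
  · rintro ⟨h1, h2⟩; exact ⟨(this.2 ⟨h1, by omega⟩).1, h2⟩

theorem sInf_eq_of_inter {Y Z : Set ℕ} (hY : Y.Nonempty) {n : ℕ} (hn : sInf Y < n)
    (e : Z ∩ Iio n = Y ∩ Iio n) : sInf Z = sInf Y := by
  have h1 : sInf Y ∈ Z := by
    have : sInf Y ∈ Z ∩ Iio n := e ▸ ⟨Nat.sInf_mem hY, hn⟩
    exact this.1
  have h2 : sInf Z ≤ sInf Y := Nat.sInf_le h1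
  have h3 : sInf Z ∈ Y ∩ Iio n := e ▸ ⟨Nat.sInf_mem ⟨_, h1⟩, lt_of_le_of_lt h2 hn⟩
  exact le_antisymm h2 (Nat.sInf_le h3.1)

theorem LocConst.mono {Q : Type*} {A B : Set ℕ} {f : Set ℕ → Q} (h : LocConst A f)
    (hBA : B ⊆ A) : LocConst B f := fun Y hY => by
  obtain ⟨n, hn⟩ := h Y (hY.mono hBA)
  exact ⟨n, fun Z hZ => hn Z (hZ.mono hBA)⟩

theorem LocConst.map {Q W : Type*} {A : Set ℕ} {f : Set ℕ → Q} (h : LocConst A f)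
    (F : Q → W) : LocConst A (fun Y => F (f Y)) := fun Y hY => by
  obtain ⟨n, hn⟩ := h Y hY
  exact ⟨n, fun Z hZ e => congrArg F (hn Z hZ e)⟩

theorem LocConst.map₂ {Q Q' W : Type*} {A : Set ℕ} {f : Set ℕ → Q} {g : Set ℕ → Q'}
    (hf : LocConst A f) (hg : LocConst A g) (F : Q → Q' → W) :
    LocConst A (fun Y => F (f Y) (g Y)) := fun Y hY => by
  obtain ⟨n, hn⟩ := hf Y hY
  obtain ⟨m, hm⟩ := hg Y hY
  refine ⟨max n m, fun Z hZ e => ?_⟩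
  simp only [hn Z hZ (inter_Iio_of_le (le_max_left _ _) e),
    hm Z hZ (inter_Iio_of_le (le_max_right _ _) e)]

theorem LocConst.shift {Q : Type*} {A : Set ℕ} {f : Set ℕ → Q} (h : LocConst A f) :
    LocConst A (fun Y => f (shift Y)) := fun Y hY => by
  obtain ⟨n, hn⟩ := h _ hY.shift
  refine ⟨max n (sInf Y + 1), fun Z hZ e => hn _ hZ.shift ?_⟩
  have e1 := sInf_eq_of_inter hY.2.nonempty (lt_of_lt_of_le (Nat.lt_succ_self _)
    (le_max_right n (sInf Y + 1))) e
  have e2 := inter_Iio_of_le (le_max_left _ _) e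
  simp only [NashWilliams.shift, e1]
  ext x
  have := Set.ext_iff.1 e2 x
  simp only [mem_inter_iff, mem_sdiff, mem_Iio] at this ⊢
  tauto

theorem locConst_sInf {Q : Type*} (A : Set ℕ) (s : ℕ → Q) :
    LocConst A (fun Y => s (sInf Y)) := fun Y hY =>
  ⟨sInf Y + 1, fun _ _ e => congrArg s
    (sInf_eq_of_inter hY.2.nonempty (Nat.lt_succ_self _) e)⟩

theorem sInf_lt_sInf_shift {Y : Set ℕ} (h : Y.Infinite) : sInf Y < sInf (shift Y) := by
  have h1 : sInf (shift Y) ∈ shift Y :=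
    Nat.sInf_mem (h.sdiff (finite_singleton (sInf Y))).nonempty
  exact lt_of_le_of_ne (Nat.sInf_le h1.1) (fun e => h1.2 e.symm)

theorem BQO.wqo {Q : Type*} {r : Q → Q → Prop} {S : Set Q} (h : BQO r S) : WQO r S := by
  intro s hs
  by_contra! hc
  exact h univ infinite_univ _ (locConst_sInf univ s) (fun Y _ => hs _)
    (fun Y hY => hc _ _ (sInf_lt_sInf_shift hY.2))

theorem BQO.subset {Q : Type*} {r : Q → Q → Prop} {S T : Set Q} (h : BQO r T) (hST : S ⊆ T) :
    BQO r S := fun A hA f hf hS => h A hA f hf fun Y hY => hST (hS Y hY)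

theorem WQO.subset {Q : Type*} {r : Q → Q → Prop} {S T : Set Q} (h : WQO r T) (hST : S ⊆ T) :
    WQO r S := fun s hs => h s fun i => hST (hs i)

theorem not_descending_array {W : Type*} {lt : W → W → Prop} (hwf : WellFounded lt)
    {B : Set ℕ} (hB : B.Infinite) (m : Set ℕ → W) :
    ¬ ∀ Y, InfSub B Y → lt (m (shift Y)) (m Y) := by
  intro h
  suffices H : ∀ w, ∀ Y, InfSub B Y → m Y ≠ w from H _ B (InfSub.refl hB) rfl
  intro w
  induction w using hwf.induction with
  | _ w ih =>
    rintro Y hY rfl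
    exact ih _ (h Y hY) _ hY.shift rfl

/-! ### The clopen Ramsey theorem -/

theorem exists_infinite_of_end_extension {A : Set ℕ} (Φ : Finset ℕ → Prop) (h0 : Φ ∅)
    (hs : ∀ s, Φ s → ∃ n ∈ A, (∀ m ∈ s, m < n) ∧ Φ (insert n s)) :
    ∃ Y, InfSub A Y ∧ ∀ m, ∃ n, m ≤ n ∧ ∃ s, Φ s ∧ Y ∩ Iio n = (s : Set ℕ) := by
  choose! e heA hlt hΦ using hs
  let s : ℕ → Finset ℕ := fun k => Nat.rec ∅ (fun _ s => insert (e s) s) k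
  have s_succ : ∀ k, s (k + 1) = insert (e (s k)) (s k) := fun k => rfl
  have hΦs : ∀ k, Φ (s k) := fun k => by
    induction k with
    | zero => exact h0
    | succ k ih => exact hΦ _ ih
  have hmem : ∀ k x, x ∈ s k ↔ ∃ j < k, e (s j) = x := fun k x => by
    induction k with
    | zero => simp [s]
    | succ k ih =>
      rw [s_succ, Finset.mem_insert, ih]
      constructor
      · rintro (rfl | ⟨j, hj, rfl⟩)
        · exact ⟨k, by omega, rfl⟩
        · exact ⟨j, by omega, rfl⟩
      · rintro ⟨j, hj, rfl⟩
        rcases Nat.lt_succ_iff_lt_or_eq.1 hj with h | rfl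
        · exact Or.inr ⟨j, h, rfl⟩
        · exact Or.inl rfl
  have hmono : StrictMono (fun k => e (s k)) := by
    refine strictMono_nat_of_lt_succ fun k => ?_
    exact hlt _ (hΦs (k + 1)) _ ((hmem _ _).2 ⟨k, Nat.lt_succ_self k, rfl⟩)
  refine ⟨range fun k => e (s k), ⟨?_, infinite_range_of_injective hmono.injective⟩, fun m => ?_⟩
  · rintro _ ⟨k, rfl⟩
    exact heA _ (hΦs k)
  · refine ⟨e (s m), hmono.id_le m, s m, hΦs m, ?_⟩
    ext x
    simp only [mem_inter_iff, mem_range, mem_Iio, Finset.mem_coe, hmem]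
    constructor
    · rintro ⟨⟨j, rfl⟩, hj⟩
      exact ⟨j, hmono.lt_iff_lt.1 hj, rfl⟩
    · rintro ⟨j, hj, rfl⟩
      exact ⟨⟨j, rfl⟩, hmono hj⟩

/-- The finite set `s` accepts `P`: either all infinite subsets of `A` with initial segment `s`
satisfy `P`, or almost all one-point extensions of `s` accept `P`. -/
inductive Accepts (U : Ultrafilter ℕ) (A : Set ℕ) (P : Set ℕ → Prop) : Finset ℕ → Prop
  | base (s : Finset ℕ) (N : ℕ) (hN : ∀ m ∈ s, m < N)
      (h : ∀ Y, InfSub A Y → Y ∩ Iio N = (s : Set ℕ) → P Y) : Accepts U A P s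
  | step (s : Finset ℕ) (S : Set ℕ) (hS : S ∈ U) (h : ∀ n ∈ S, Accepts U A P (insert n s)) :
      Accepts U A P s

section Ramsey

variable {U : Ultrafilter ℕ} {A : Set ℕ} {P : Set ℕ → Prop}

theorem eventually_ge_of_le_cofinite (hU : (U : Filter ℕ) ≤ Filter.cofinite) (N : ℕ) :
    ∀ᶠ n in (U : Filter ℕ), N ≤ n := by
  apply hU
  rw [Nat.cofinite_eq_atTop]
  exact Filter.eventually_ge_atTop N

theorem eventually_gt_finset (hU : (U : Filter ℕ) ≤ Filter.cofinite) (s : Finset ℕ) :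
    ∀ᶠ n in (U : Filter ℕ), ∀ m ∈ s, m < n := by
  obtain ⟨b, hb⟩ := s.bddAbove
  filter_upwards [eventually_ge_of_le_cofinite hU (b + 1)] with n hn m hm
  exact lt_of_le_of_lt (hb hm) hn

theorem Accepts.eventually (hU : (U : Filter ℕ) ≤ Filter.cofinite) {s : Finset ℕ}
    (h : Accepts U A P s) : ∀ᶠ n in (U : Filter ℕ), Accepts U A P (insert n s) := by
  cases h with
  | step _ S hS h => exact Filter.mem_of_superset hS h
  | base _ N hN h =>
    filter_upwards [eventually_ge_of_le_cofinite hU N] with n hn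
    refine .base _ (n + 1) (fun m hm => ?_) fun Y hY hk => h Y hY ?_
    · rcases Finset.mem_insert.1 hm with rfl | hm
      · omega
      · have := hN _ hm; omega
    · ext x
      have hx := Set.ext_iff.1 hk x
      simp only [mem_inter_iff, mem_Iio, Finset.coe_insert, mem_insert_iff,
        Finset.mem_coe] at hx ⊢
      constructor
      · rintro ⟨h1, h2⟩
        rcases hx.1 ⟨h1, by omega⟩ with rfl | h
        · omega
        · exact h
      · intro h
        exact ⟨(hx.2 (Or.inr h)).1, hN _ h⟩

theorem Accepts.exists_infSub (hA : A.Infinite) (hU : (U : Filter ℕ) ≤ Filter.cofinite)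
    (hUA : ∀ᶠ n in (U : Filter ℕ), n ∈ A) {s : Finset ℕ}
    (h : Accepts U A P s) : (s : Set ℕ) ⊆ A → ∀ N, (∀ m ∈ s, m < N) →
      ∃ W, InfSub A W ∧ W ∩ Iio N = (s : Set ℕ) ∧ P W := by
  induction h with
  | base s M hM h =>
    intro hs N hN
    have hW : InfSub A ((s : Set ℕ) ∪ (A \ Iio (max M N))) :=
      ⟨union_subset hs sdiff_subset, ((hA.sdiff (finite_Iio _)).mono subset_union_right)⟩
    have e : ∀ k ≤ max M N, (∀ m ∈ s, m < k) →
        ((s : Set ℕ) ∪ (A \ Iio (max M N))) ∩ Iio k = (s : Set ℕ) := by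
      intro k hk hsk
      ext x
      simp only [mem_inter_iff, mem_union, Finset.mem_coe, mem_sdiff, mem_Iio]
      constructor
      · rintro ⟨h | h, h'⟩
        · exact h
        · exact absurd (lt_of_lt_of_le h' hk) h.2
      · exact fun h => ⟨Or.inl h, hsk _ h⟩
    exact ⟨_, hW, e N (le_max_right _ _) hN, h _ hW (e M (le_max_left _ _) hM)⟩
  | step s S hS h ih =>
    intro hs N hN
    obtain ⟨n, h1, h2, h3⟩ := ((show ∀ᶠ n in (U : Filter ℕ), n ∈ S from hS).and
      (hUA.and (eventually_ge_of_le_cofinite hU N))).exists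
    obtain ⟨W, hW, e, hP⟩ := ih n h1 (by
      rw [Finset.coe_insert]; exact insert_subset h2 hs) (n + 1) (by
      intro m hm
      rcases Finset.mem_insert.1 hm with rfl | hm
      · omega
      · have := hN _ hm; omega)
    refine ⟨W, hW, ?_, hP⟩
    ext x
    have hx := Set.ext_iff.1 e x
    simp only [mem_inter_iff, mem_Iio, Finset.coe_insert, mem_insert_iff, Finset.mem_coe] at hx ⊢
    constructor
    · rintro ⟨h4, h5⟩
      rcases hx.1 ⟨h4, by omega⟩ with rfl | h
      · omega
      · exact h
    · intro h
      exact ⟨(hx.2 (Or.inr h)).1, hN _ h⟩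

theorem accepts_or_accepts_not (hU : (U : Filter ℕ) ≤ Filter.cofinite)
    (hUA : ∀ᶠ n in (U : Filter ℕ), n ∈ A) (hP : LocConst A P) :
    Accepts U A P ∅ ∨ Accepts U A (fun Y => ¬ P Y) ∅ := by
  by_contra hc
  push Not at hc
  obtain ⟨Y, hY, h⟩ := exists_infinite_of_end_extension (A := A)
    (fun s => ¬ Accepts U A P s ∧ ¬ Accepts U A (fun Y => ¬ P Y) s) hc (by
      rintro s ⟨h1, h2⟩
      have h1' : ∀ᶠ n in (U : Filter ℕ), ¬ Accepts U A P (insert n s) := by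
        rw [Ultrafilter.eventually_not]; exact fun h => h1 (.step _ _ h fun _ hn => hn)
      have h2' : ∀ᶠ n in (U : Filter ℕ), ¬ Accepts U A (fun Y => ¬ P Y) (insert n s) := by
        rw [Ultrafilter.eventually_not]; exact fun h => h2 (.step _ _ h fun _ hn => hn)
      obtain ⟨n, a, b, c, d⟩ :=
        (h1'.and (h2'.and (hUA.and (eventually_gt_finset hU s)))).exists
      exact ⟨n, c, d, a, b⟩)
  obtain ⟨m, hm⟩ := hP Y hY
  obtain ⟨n, hmn, s, ⟨h1, h2⟩, hs⟩ := h m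
  have hsn : ∀ m ∈ s, m < n := fun m hm => by
    have : m ∈ Y ∩ Iio n := hs ▸ hm
    exact this.2
  have key : ∀ Z, InfSub A Z → Z ∩ Iio n = (s : Set ℕ) → (P Z ↔ P Y) := fun Z hZ e =>
    iff_of_eq (hm Z hZ (inter_Iio_of_le hmn (e.trans hs.symm)))
  by_cases hPY : P Y
  · exact h1 (.base _ n hsn fun Z hZ hk => (key Z hZ hk).2 hPY)
  · exact h2 (.base _ n hsn fun Z hZ hk => fun h => hPY ((key Z hZ hk).1 h))

theorem Accepts.homogeneous (hA : A.Infinite) (hU : (U : Filter ℕ) ≤ Filter.cofinite)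
    (hUA : ∀ᶠ n in (U : Filter ℕ), n ∈ A) (hP : LocConst A P) (h : Accepts U A P ∅) :
    ∃ B, InfSub A B ∧ ∀ Y, InfSub B Y → P Y := by
  obtain ⟨B, hB, hBs⟩ := exists_infinite_of_end_extension (A := A)
    (fun s => (s : Set ℕ) ⊆ A ∧ ∀ t ⊆ s, Accepts U A P t)
    ⟨by simp, fun t ht => by rwa [Finset.subset_empty.1 ht]⟩ (by
      rintro s ⟨hsA, hs⟩
      have h1 : ∀ᶠ n in (U : Filter ℕ), ∀ t ∈ s.powerset, Accepts U A P (insert n t) :=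
        (Filter.eventually_all_finset _).2 fun t ht =>
          (hs t (Finset.mem_powerset.1 ht)).eventually hU
      obtain ⟨n, a, b, c⟩ := (h1.and (hUA.and (eventually_gt_finset hU s))).exists
      refine ⟨n, b, c, by rw [Finset.coe_insert]; exact insert_subset b hsA, fun t ht => ?_⟩
      by_cases hn : n ∈ t
      · rw [← Finset.insert_erase hn]
        exact a _ (Finset.mem_powerset.2 (Finset.subset_insert_iff.1 ht))
      · exact hs t ((Finset.subset_insert_iff_of_notMem hn).1 ht))
  refine ⟨B, hB, fun Z hZ => ?_⟩
  obtain ⟨m, hm⟩ := hP Z (hZ.mono hB.1)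
  obtain ⟨n, hmn, s, ⟨hsA, hs⟩, e⟩ := hBs m
  have hfin : (Z ∩ Iio n).Finite := (finite_Iio n).subset inter_subset_right
  obtain ⟨W, hW, e', hPW⟩ := (hs hfin.toFinset (by
    intro x hx
    have hx := hfin.mem_toFinset.1 hx
    have : x ∈ B ∩ Iio n := ⟨hZ.1 hx.1, hx.2⟩
    rwa [e] at this)).exists_infSub hA hU hUA (by
      rw [hfin.coe_toFinset]; exact inter_subset_left.trans (hZ.1.trans hB.1)) n
      (fun x hx => (hfin.mem_toFinset.1 hx).2)
  rw [hfin.coe_toFinset] at e'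
  exact (iff_of_eq (hm W hW (inter_Iio_of_le hmn e'))).1 hPW

theorem ramsey (hA : A.Infinite) (hP : LocConst A P) :
    ∃ B, InfSub A B ∧ ((∀ Y, InfSub B Y → P Y) ∨ ∀ Y, InfSub B Y → ¬ P Y) := by
  have hne : (Filter.cofinite ⊓ Filter.principal A).NeBot :=
    Filter.frequently_mem_iff_neBot.1 (Nat.cofinite_eq_atTop ▸
      Nat.frequently_atTop_iff_infinite.2 hA)
  let U := Ultrafilter.of (Filter.cofinite ⊓ Filter.principal A)
  have hle := Ultrafilter.of_le (Filter.cofinite ⊓ Filter.principal A)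
  have hU : (U : Filter ℕ) ≤ Filter.cofinite := hle.trans inf_le_left
  have hUA : ∀ᶠ n in (U : Filter ℕ), n ∈ A := Filter.le_principal_iff.1 (hle.trans inf_le_right)
  rcases accepts_or_accepts_not hU hUA hP with h | h
  · obtain ⟨B, hB, h⟩ := h.homogeneous hA hU hUA hP
    exact ⟨B, hB, Or.inl h⟩
  · obtain ⟨B, hB, h⟩ := h.homogeneous hA hU hUA (hP.map Not)
    exact ⟨B, hB, Or.inr h⟩

end Ramsey

/-- The infinite subsets of `A` whose part below `N` is `t`. -/
def node (N : ℕ) (t A : Set ℕ) : Set (Set ℕ) := {Y | InfSub A Y ∧ Y ∩ Iio N = t}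

theorem node_mono {N : ℕ} {t A B : Set ℕ} (h : B ⊆ A) : node N t B ⊆ node N t A :=
  fun _ hY => ⟨hY.1.mono h, hY.2⟩

theorem ramsey_node {A : Set ℕ} {P : Set ℕ → Prop} (hA : A.Infinite) (hP : LocConst A P)
    (N : ℕ) (t : Set ℕ) : ∃ B, InfSub A B ∧ B ∩ Iio N = A ∩ Iio N ∧
      ((∀ Y ∈ node N t B, P Y) ∨ ∀ Y ∈ node N t B, ¬ P Y) := by
  by_cases ht : t ⊆ A ∩ Iio N
  swap
  · refine ⟨A, InfSub.refl hA, rfl, Or.inl fun Y hY => (ht ?_).elim⟩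
    rw [← hY.2]
    exact inter_subset_inter_left _ hY.1.1
  have key : ∀ Y, InfSub (A \ Iio N) Y → InfSub A (t ∪ Y) := fun Y hY =>
    ⟨union_subset (ht.trans inter_subset_left) (hY.1.trans sdiff_subset),
      hY.2.mono subset_union_right⟩
  obtain ⟨B, hB, h⟩ := ramsey (A := A \ Iio N) (P := fun Y => P (t ∪ Y))
    (hA.sdiff (finite_Iio N)) fun Y hY => by
      obtain ⟨n, hn⟩ := hP _ (key Y hY)
      exact ⟨n, fun Z hZ e => hn _ (key Z hZ) (by
        rw [union_inter_distrib_right, union_inter_distrib_right, e])⟩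
  have hBN : ∀ x ∈ B, N ≤ x := fun x hx => not_lt.1 (hB.1 hx).2
  have hlt : ∀ Y ∈ node N t ((A ∩ Iio N) ∪ B), InfSub B (Y \ Iio N) ∧ t ∪ (Y \ Iio N) = Y := by
    rintro Y ⟨⟨h1, h2⟩, h3⟩
    refine ⟨⟨fun x hx => (h1 hx.1).resolve_left fun h => hx.2 h.2, h2.sdiff (finite_Iio N)⟩, ?_⟩
    rw [← h3, inter_union_sdiff]
  refine ⟨(A ∩ Iio N) ∪ B, ⟨union_subset inter_subset_left (hB.1.trans sdiff_subset),
    hB.2.mono subset_union_right⟩, ?_, ?_⟩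
  · ext x
    have := hBN x
    simp only [mem_inter_iff, mem_union, mem_Iio]
    constructor
    · rintro ⟨h | h, h'⟩
      · exact h
      · exact absurd h' (not_lt.2 (this h))
    · exact fun h => ⟨Or.inl h, h.2⟩
  · refine h.imp (fun h Y hY => ?_) (fun h Y hY => ?_)
    · have := h _ (hlt Y hY).1
      rwa [(hlt Y hY).2] at this
    · have := h _ (hlt Y hY).1
      rwa [(hlt Y hY).2] at this

theorem ramsey_nodes {A : Set ℕ} {P : Set ℕ → Prop} (hA : A.Infinite) (hP : LocConst A P)
    (N : ℕ) : ∃ B, InfSub A B ∧ B ∩ Iio N = A ∩ Iio N ∧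
      ∀ t, (∀ Y ∈ node N t B, P Y) ∨ ∀ Y ∈ node N t B, ¬ P Y := by
  have hfin : (𝒫 (Iio N)).Finite := (finite_Iio N).finite_subsets
  suffices H : ∀ F : Set (Set ℕ), F.Finite → ∃ B, InfSub A B ∧ B ∩ Iio N = A ∩ Iio N ∧
      ∀ t ∈ F, (∀ Y ∈ node N t B, P Y) ∨ ∀ Y ∈ node N t B, ¬ P Y by
    obtain ⟨B, h1, h2, h3⟩ := H _ hfin
    refine ⟨B, h1, h2, fun t => ?_⟩
    by_cases ht : t ⊆ Iio N
    · exact h3 t ht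
    · exact Or.inl fun Y hY => (ht (hY.2 ▸ inter_subset_right)).elim
  intro F hF
  induction F, hF using Set.Finite.induction_on with
  | empty => exact ⟨A, InfSub.refl hA, rfl, by simp⟩
  | insert _ _ ih =>
    obtain ⟨B, h1, h2, h3⟩ := ih
    rename_i t F _ _
    obtain ⟨C, h4, h5, h6⟩ := ramsey_node h1.2 (hP.mono h1.1) N t
    refine ⟨C, h4.mono h1.1, h5.trans h2, fun u hu => ?_⟩
    rcases mem_insert_iff.1 hu with rfl | hu
    · exact h6
    · exact (h3 u hu).imp (fun h Y hY => h Y (node_mono h4.1 hY))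
        (fun h Y hY => h Y (node_mono h4.1 hY))

/-! ### Minimal bad arrays -/

section MinimalBadArray

variable {Q : Type*} {le lt : Q → Q → Prop}

/-- A configuration `(A, f)` is a bad array `f` on the infinite set `A`. -/
def Conf (le : Q → Q → Prop) (c : Set ℕ × (Set ℕ → Q)) : Prop :=
  c.1.Infinite ∧ LocConst c.1 c.2 ∧ Bad le c.1 c.2

/-- The bad array `d` lies below `c`, keeps the part of the domain below `N` and the values
on `R`. -/
def Ext (le lt : Q → Q → Prop) (N : ℕ) (R : Set (Set ℕ)) (c d : Set ℕ × (Set ℕ → Q)) : Prop :=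
  Conf le d ∧ d.1 ⊆ c.1 ∧ d.1 ∩ Iio N = c.1 ∩ Iio N ∧
    (∀ Y, InfSub d.1 Y → d.2 Y = c.2 Y ∨ lt (d.2 Y) (c.2 Y)) ∧
    ∀ Y, InfSub d.1 Y → Y ∈ R → d.2 Y = c.2 Y

theorem Ext.refl {N : ℕ} {R : Set (Set ℕ)} {c : Set ℕ × (Set ℕ → Q)} (h : Conf le c) :
    Ext le lt N R c c :=
  ⟨h, Subset.rfl, rfl, fun _ _ => Or.inl rfl, fun _ _ _ => rfl⟩

theorem Ext.trans (htr : ∀ a b c, lt a b → lt b c → lt a c) {N : ℕ} {R : Set (Set ℕ)}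
    {c d e : Set ℕ × (Set ℕ → Q)} (h : Ext le lt N R c d) (h' : Ext le lt N R d e) :
    Ext le lt N R c e := by
  refine ⟨h'.1, h'.2.1.trans h.2.1, h'.2.2.1.trans h.2.2.1, fun Y hY => ?_, fun Y hY hR => ?_⟩
  · rcases h'.2.2.2.1 Y hY with h1 | h1 <;> rcases h.2.2.2.1 Y (hY.mono h'.2.1) with h2 | h2
    · exact Or.inl (h1.trans h2)
    · exact Or.inr (h1 ▸ h2)
    · exact Or.inr (h2 ▸ h1)
    · exact Or.inr (htr _ _ _ h1 h2)
  · exact (h'.2.2.2.2 Y hY hR).trans (h.2.2.2.2 Y (hY.mono h'.2.1) hR)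

theorem Ext.weaken {N N' : ℕ} {R R' : Set (Set ℕ)} {c d : Set ℕ × (Set ℕ → Q)}
    (h : Ext le lt N' R' c d) (hN : N ≤ N') (hR : R ⊆ R') : Ext le lt N R c d :=
  ⟨h.1, h.2.1, inter_Iio_of_le hN h.2.2.1, h.2.2.2.1, fun Y hY hY' => h.2.2.2.2 Y hY (hR hY')⟩

theorem node_nonempty {A : Set ℕ} (hA : A.Infinite) {N : ℕ} {t : Set ℕ} (ht : t ⊆ A ∩ Iio N) :
    (node N t A).Nonempty := by
  refine ⟨t ∪ (A \ Iio N), ⟨union_subset (ht.trans inter_subset_left) sdiff_subset,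
    (hA.sdiff (finite_Iio N)).mono subset_union_right⟩, ?_⟩
  ext x
  have := @ht x
  simp only [mem_inter_iff, mem_union, mem_sdiff, mem_Iio] at this ⊢
  tauto

/-- Either every array below `d` takes the value `q` on the node given by `t`, or no array
below `d` is constant there. -/
def Settled (le lt : Q → Q → Prop) (N : ℕ) (R : Set (Set ℕ)) (t : Set ℕ)
    (d : Set ℕ × (Set ℕ → Q)) : Prop :=
  (∃ q, ∀ e, Ext le lt N R d e → ∃ Y ∈ node N t e.1, e.2 Y = q) ∨
    ∀ e, Ext le lt N R d e → ¬ ∃ q, ∀ Y ∈ node N t e.1, e.2 Y = q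

theorem Settled.of_ext (htr : ∀ a b c, lt a b → lt b c → lt a c) {N : ℕ} {R : Set (Set ℕ)}
    {t : Set ℕ} {c d : Set ℕ × (Set ℕ → Q)} (hc : Settled le lt N R t c)
    (h : Ext le lt N R c d) : Settled le lt N R t d :=
  hc.imp (fun ⟨q, hq⟩ => ⟨q, fun e he => hq e (h.trans htr he)⟩)
    (fun hq e he => hq e (h.trans htr he))

theorem exists_settled (hwf : WellFounded lt) (htr : ∀ a b c, lt a b → lt b c → lt a c)
    {c : Set ℕ × (Set ℕ → Q)} (hc : Conf le c) {N : ℕ} (R : Set (Set ℕ)) {t : Set ℕ}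
    (ht : t ⊆ c.1 ∩ Iio N) : ∃ d, Ext le lt N R c d ∧ Settled le lt N R t d := by
  rcases {q | ∃ d, Ext le lt N R c d ∧ ∀ Y ∈ node N t d.1, d.2 Y = q}.eq_empty_or_nonempty
    with hS | hS
  · refine ⟨c, Ext.refl hc, Or.inr ?_⟩
    rintro e he ⟨q, hq⟩
    exact eq_empty_iff_forall_notMem.1 hS q ⟨e, he, hq⟩
  · obtain ⟨q, ⟨d, hd, hq⟩, hmin⟩ := hwf.has_min _ hS
    by_cases h : ∀ e, Ext le lt N R d e → ∃ Y ∈ node N t e.1, e.2 Y = q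
    · exact ⟨d, hd, Or.inl ⟨q, h⟩⟩
    · push Not at h
      obtain ⟨e, he, hne⟩ := h
      refine ⟨e, hd.trans htr he, Or.inr ?_⟩
      rintro e' he' ⟨q', hq'⟩
      refine hmin q' ⟨e', (hd.trans htr he).trans htr he', hq'⟩ ?_
      have htot := (hd.trans htr he).trans htr he'
      obtain ⟨Y, hY⟩ := node_nonempty (t := t) (N := N) he'.1.1 (by rwa [htot.2.2.1])
      have hYe := node_mono he'.2.1 hY
      have hYd := node_mono he.2.1 hYe
      have h1 : lt (e.2 Y) q :=
        hq Y hYd ▸ (he.2.2.2.1 Y hYe.1).resolve_left (fun h => hne Y hYe (h.trans (hq Y hYd)))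
      rw [← hq' Y hY]
      rcases he'.2.2.2.1 Y hY.1 with h2 | h2
      · rwa [h2]
      · exact htr _ _ _ h2 h1

theorem exists_settled_all (hwf : WellFounded lt) (htr : ∀ a b c, lt a b → lt b c → lt a c)
    {c : Set ℕ × (Set ℕ → Q)} (hc : Conf le c) (N : ℕ) (R : Set (Set ℕ)) :
    ∃ d, Ext le lt N R c d ∧ (∀ t ⊆ c.1 ∩ Iio N, Settled le lt N R t d) ∧
      ∀ t, (∀ Y ∈ node N t d.1, d.2 Y = c.2 Y) ∨ ∀ Y ∈ node N t d.1, ¬ d.2 Y = c.2 Y := by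
  have h1 : ∃ d, Ext le lt N R c d ∧ ∀ t ⊆ c.1 ∩ Iio N, Settled le lt N R t d := by
    have hfin : {t | t ⊆ c.1 ∩ Iio N}.Finite :=
      ((finite_Iio N).subset inter_subset_right).finite_subsets
    suffices H : ∀ F : Set (Set ℕ), F.Finite → F ⊆ {t | t ⊆ c.1 ∩ Iio N} →
        ∃ d, Ext le lt N R c d ∧ ∀ t ∈ F, Settled le lt N R t d by
      exact H _ hfin Subset.rfl
    intro F hF
    induction F, hF using Set.Finite.induction_on with
    | empty => exact fun _ => ⟨c, Ext.refl hc, by simp⟩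
    | insert _ _ ih =>
      rename_i t F _ _
      intro hsub
      obtain ⟨d, hd, hs⟩ := ih ((subset_insert _ _).trans hsub)
      obtain ⟨e, he, hs'⟩ := exists_settled hwf htr hd.1 R (t := t) (N := N) (by
        rw [hd.2.2.1]; exact hsub (mem_insert _ _))
      refine ⟨e, hd.trans htr he, fun u hu => ?_⟩
      rcases mem_insert_iff.1 hu with rfl | hu
      · exact hs'
      · exact (hs u hu).of_ext htr he
  obtain ⟨d, hd, hs⟩ := h1
  obtain ⟨B, hB, hBN, h⟩ := ramsey_nodes (P := fun Y => d.2 Y = c.2 Y) hd.1.1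
    (hd.1.2.1.map₂ ((show LocConst c.1 c.2 from hc.2.1).mono hd.2.1) Eq) N
  have he : Ext le lt N R d (B, d.2) :=
    ⟨⟨hB.2, hd.1.2.1.mono hB.1, fun Y hY => hd.1.2.2 Y (hY.mono hB.1)⟩, hB.1, hBN,
      fun _ _ => Or.inl rfl, fun _ _ _ => rfl⟩
  exact ⟨(B, d.2), hd.trans htr he, fun t ht => (hs t ht).of_ext htr he, h⟩

theorem exists_settled_seq (hwf : WellFounded lt) (htr : ∀ a b c, lt a b → lt b c → lt a c)
    {c₀ : Set ℕ × (Set ℕ → Q)} (hc₀ : Conf le c₀) :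
    ∃ (c : ℕ → Set ℕ × (Set ℕ → Q)) (N : ℕ → ℕ) (R : ℕ → Set (Set ℕ)), c 0 = c₀ ∧ R 0 = ∅ ∧
      ∀ i, (∃ a ∈ (c i).1, N i ≤ a ∧ a < N (i + 1)) ∧ Conf le (c i) ∧
        Ext le lt (N (i + 1)) (R i) (c i) (c (i + 1)) ∧
        (∀ t ⊆ (c i).1 ∩ Iio (N (i + 1)), Settled le lt (N (i + 1)) (R i) t (c (i + 1))) ∧
        (∀ t, (∀ Y ∈ node (N (i + 1)) t (c (i + 1)).1, (c (i + 1)).2 Y = (c i).2 Y) ∨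
          ∀ Y ∈ node (N (i + 1)) t (c (i + 1)).1, ¬ (c (i + 1)).2 Y = (c i).2 Y) ∧
        R (i + 1) = R i ∪ {Y | ∃ q, ∀ Z ∈ node (N (i + 1)) (Y ∩ Iio (N (i + 1))) (c (i + 1)).1,
          (c (i + 1)).2 Z = q} := by
  have step : ∀ s : (Set ℕ × (Set ℕ → Q)) × ℕ × Set (Set ℕ), Conf le s.1 →
      ∃ s' : (Set ℕ × (Set ℕ → Q)) × ℕ × Set (Set ℕ),
        (∃ a ∈ s.1.1, s.2.1 ≤ a ∧ a < s'.2.1) ∧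
        Ext le lt s'.2.1 s.2.2 s.1 s'.1 ∧
        (∀ t ⊆ s.1.1 ∩ Iio s'.2.1, Settled le lt s'.2.1 s.2.2 t s'.1) ∧
        (∀ t, (∀ Y ∈ node s'.2.1 t s'.1.1, s'.1.2 Y = s.1.2 Y) ∨
          ∀ Y ∈ node s'.2.1 t s'.1.1, ¬ s'.1.2 Y = s.1.2 Y) ∧
        s'.2.2 = s.2.2 ∪ {Y | ∃ q, ∀ Z ∈ node s'.2.1 (Y ∩ Iio s'.2.1) s'.1.1, s'.1.2 Z = q} := by
    rintro ⟨c, N, R⟩ hc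
    obtain ⟨a, ha, hNa⟩ := hc.1.exists_gt N
    obtain ⟨d, h1, h2, h3⟩ := exists_settled_all hwf htr hc (a + 1) R
    exact ⟨(d, a + 1, R ∪ {Y | ∃ q, ∀ Z ∈ node (a + 1) (Y ∩ Iio (a + 1)) d.1, d.2 Z = q}),
      ⟨a, ha, hNa.le, Nat.lt_succ_self a⟩, h1, h2, h3, rfl⟩
  choose! F hF using step
  let s : ℕ → (Set ℕ × (Set ℕ → Q)) × ℕ × Set (Set ℕ) := fun i =>
    Nat.rec (c₀, 0, ∅) (fun _ s => F s) i
  have hconf : ∀ i, Conf le (s i).1 := fun i => by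
    induction i with
    | zero => exact hc₀
    | succ i ih => exact (hF _ ih).2.1.1
  refine ⟨fun i => (s i).1, fun i => (s i).2.1, fun i => (s i).2.2, rfl, rfl, fun i => ?_⟩
  obtain ⟨h1, h2, h3, h4, h5⟩ := hF _ (hconf i)
  exact ⟨h1, hconf i, h2, h3, h4, h5⟩

/-- The minimal bad array lemma. -/
theorem exists_minimal_bad (hwf : WellFounded lt) (htr : ∀ a b c, lt a b → lt b c → lt a c)
    (hmono : ∀ a b b', le a b' → lt b' b → le a b)
    {A₀ : Set ℕ} (hA₀ : A₀.Infinite) {f₀ : Set ℕ → Q} (hf₀ : LocConst A₀ f₀)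
    (hbad₀ : Bad le A₀ f₀) :
    ∃ A f, InfSub A₀ A ∧ LocConst A f ∧ Bad le A f ∧
      (∀ Y, InfSub A Y → f Y = f₀ Y ∨ lt (f Y) (f₀ Y)) ∧
      ∀ B h, InfSub A B → LocConst B h → (∀ Y, InfSub B Y → lt (h Y) (f Y)) →
        ¬ Bad le B h := by
  classical
  obtain ⟨c, N, R, hc0, hR0, hstep⟩ :=
    exists_settled_seq hwf htr (c₀ := (A₀, f₀)) ⟨hA₀, hf₀, hbad₀⟩
  choose a ha hNa haN using fun i => (hstep i).1
  have hconf : ∀ i, Conf le (c i) := fun i => (hstep i).2.1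
  have hext := fun i => (hstep i).2.2.1
  have hsett := fun i => (hstep i).2.2.2.1
  have hhom := fun i => (hstep i).2.2.2.2.1
  have hR := fun i => (hstep i).2.2.2.2.2
  have hN : StrictMono N := strictMono_nat_of_lt_succ fun i => (hNa i).trans_lt (haN i)
  have hRm : Monotone R := monotone_nat_of_le_succ fun i => by
    rw [hR i]; exact subset_union_left
  have hExt : ∀ i j, i ≤ j → Ext le lt (N i) (R i) (c i) (c j) := by
    intro i j hij
    induction j, hij using Nat.le_induction with
    | base => exact Ext.refl (hconf i)
    | succ j hij ih =>
      exact ih.trans htr ((hext j).weaken (hN.monotone (hij.trans (Nat.le_succ j))) (hRm hij))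
  have hRopen : ∀ k Y Z, Y ∈ R k → Z ∩ Iio (N k) = Y ∩ Iio (N k) → Z ∈ R k := by
    intro k
    induction k with
    | zero => intro Y Z hY; rw [hR0] at hY; exact hY.elim
    | succ k ih =>
      intro Y Z hY e
      rw [hR k] at hY ⊢
      rcases hY with hY | hY
      · exact Or.inl (ih Y Z hY (inter_Iio_of_le (hN.monotone (Nat.le_succ k)) e))
      · right
        simp only [mem_ofPred_eq] at hY ⊢
        rwa [e]
  let A : Set ℕ := ⋂ k, (c k).1
  have hAsub : ∀ k, A ⊆ (c k).1 := fun k => iInter_subset _ k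
  have hAN : ∀ k, A ∩ Iio (N k) = (c k).1 ∩ Iio (N k) := fun k => by
    refine Subset.antisymm (inter_subset_inter_left _ (hAsub k)) fun x hx => ⟨?_, hx.2⟩
    refine mem_iInter.2 fun j => ?_
    rcases le_total k j with h | h
    · have : x ∈ (c j).1 ∩ Iio (N k) := (hExt k j h).2.2.1 ▸ hx
      exact this.1
    · exact (hExt j k h).2.1 hx.1
  have haA : ∀ k, a k ∈ A := fun k => by
    have h1 : a k ∈ (c (k + 1)).1 ∩ Iio (N (k + 1)) := (hext k).2.2.1 ▸ ⟨ha k, haN k⟩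
    rw [← hAN] at h1
    exact h1.1
  have hAinf : A.Infinite := by
    refine infinite_of_forall_exists_gt fun n => ⟨a (n + 1), haA _, ?_⟩
    have := hN.id_le (n + 1)
    have := hNa (n + 1)
    simp only [id] at *
    omega
  have hRall : ∀ Y, InfSub A Y → ∃ k, Y ∈ R k := by
    intro Y hY
    obtain ⟨_, ⟨k₀, rfl⟩, hmin⟩ := hwf.has_min (range fun k => (c k).2 Y) ⟨_, 0, rfl⟩
    have hYk : ∀ k, InfSub (c k).1 Y := fun k => hY.mono (hAsub k)
    have hst : ∀ m ≥ k₀, (c m).2 Y = (c k₀).2 Y := fun m hm =>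
      ((hExt k₀ m hm).2.2.2.1 Y (hYk m)).resolve_right (hmin _ ⟨m, rfl⟩)
    have hnode : ∀ m ≥ k₀, ∀ Z ∈ node (N m) (Y ∩ Iio (N m)) (c m).1,
        (c m).2 Z = (c k₀).2 Z := by
      intro m hm
      induction m, hm using Nat.le_induction with
      | base => exact fun _ _ => rfl
      | succ m hm ih =>
        intro Z hZ
        have hY' : Y ∈ node (N (m + 1)) (Y ∩ Iio (N (m + 1))) (c (m + 1)).1 :=
          ⟨hYk _, rfl⟩
        have h1 := ((hhom m _).resolve_right fun h => h Y hY'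
          ((hst _ (hm.trans (Nat.le_succ m))).trans (hst m hm).symm)) Z hZ
        exact h1.trans (ih Z ⟨hZ.1.mono (hext m).2.1,
          inter_Iio_of_le (hN.monotone (Nat.le_succ m)) hZ.2⟩)
    obtain ⟨n, hn⟩ := (hconf k₀).2.1 Y (hYk k₀)
    refine ⟨max k₀ n + 1, ?_⟩
    rw [hR]
    refine Or.inr ⟨(c k₀).2 Y, fun Z hZ => ?_⟩
    have hle : k₀ ≤ max k₀ n + 1 := (le_max_left _ _).trans (Nat.le_succ _)
    rw [hnode _ hle Z hZ]
    refine hn Z (hZ.1.mono (hExt _ _ hle).2.1) (inter_Iio_of_le ?_ hZ.2)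
    exact ((le_max_right k₀ n).trans (Nat.le_succ _)).trans (hN.id_le _)
  choose! κ hκ using hRall
  let f : Set ℕ → Q := fun Y => (c (κ Y)).2 Y
  have hf : ∀ Y, InfSub A Y → ∀ k, Y ∈ R k → f Y = (c k).2 Y := by
    intro Y hY k hk
    rcases le_total (κ Y) k with h | h
    · exact ((hExt _ _ h).2.2.2.2 Y (hY.mono (hAsub k)) (hκ Y hY)).symm
    · exact (hExt _ _ h).2.2.2.2 Y (hY.mono (hAsub _)) hk
  have hfle : ∀ Y, InfSub A Y → ∀ k, f Y = (c k).2 Y ∨ lt (f Y) ((c k).2 Y) := by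
    intro Y hY k
    rw [hf Y hY _ (hRm (le_max_left (κ Y) k) (hκ Y hY))]
    exact (hExt _ _ (le_max_right (κ Y) k)).2.2.2.1 Y (hY.mono (hAsub _))
  have hfloc : LocConst A f := by
    intro Y hY
    obtain ⟨n, hn⟩ := (hconf (κ Y)).2.1 Y (hY.mono (hAsub _))
    refine ⟨max n (N (κ Y)), fun Z hZ e => ?_⟩
    rw [hf Z hZ (κ Y) (hRopen _ _ _ (hκ Y hY) (inter_Iio_of_le (le_max_right _ _) e))]
    exact hn Z (hZ.mono (hAsub _)) (inter_Iio_of_le (le_max_left _ _) e)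
  have hfbad : Bad le A f := by
    intro Y hY h
    have h1 := hRm (le_max_left (κ Y) (κ (shift Y))) (hκ Y hY)
    have h2 := hRm (le_max_right (κ Y) (κ (shift Y))) (hκ _ hY.shift)
    rw [hf Y hY _ h1, hf _ hY.shift _ h2] at h
    exact (hconf _).2.2 Y (hY.mono (hAsub _)) h
  refine ⟨A, f, ⟨by simpa [hc0] using hAsub 0, hAinf⟩, hfloc, hfbad,
    fun Y hY => by simpa [hc0] using hfle Y hY 0, ?_⟩
  intro B h hB hh hlt hbad
  have hex : ∃ k, ∃ Y, InfSub B Y ∧ Y ∈ R k := ⟨κ B, B, InfSub.refl hB.2, hκ B hB⟩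
  obtain ⟨Y, hYB, hYR⟩ := Nat.find_spec hex
  have hfirst := fun {m} (hm : m < Nat.find hex) => Nat.find_min hex hm
  generalize Nat.find hex = k at hYR hfirst
  cases k with
  | zero => rw [hR0] at hYR; exact hYR
  | succ i =>
  have hnotR : ∀ Z, InfSub B Z → Z ∉ R i := fun Z hZ hZR => hfirst (Nat.lt_succ_self i) ⟨Z, hZ, hZR⟩
  rw [hR i] at hYR
  obtain ⟨q', hq'⟩ := hYR.resolve_left (hnotR Y hYB)
  set M := N (i + 1) with hM
  set t := Y ∩ Iio M with ht
  have htc : t ⊆ (c i).1 ∩ Iio M :=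
    inter_subset_inter_left _ (hYB.1.trans (hB.1.trans (hAsub i)))
  rcases hsett i t htc with ⟨q, hq⟩ | h2
  swap
  · exact h2 _ (Ext.refl (hconf _)) ⟨q', hq'⟩
  obtain rfl : q' = q := by
    obtain ⟨Z, hZ, e⟩ := hq _ (Ext.refl (hconf _))
    exact (hq' Z hZ).symm.trans e
  have hYinA : ∀ x, x ∈ (A ∩ Iio M) ∪ (B \ Iio M) → x ∈ A := by
    rintro x (hx | hx)
    · exact hx.1
    · exact hB.1 hx.1
  have hsubB : ∀ Z Z', InfSub ((A ∩ Iio M) ∪ (B \ Iio M)) Z' → Z ⊆ B →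
      Z' ∩ Iio M = Z ∩ Iio M → Z' ⊆ B := by
    intro Z Z' hZ' hZ e x hx
    by_cases hxM : x ∈ Iio M
    · have : x ∈ Z ∩ Iio M := e ▸ ⟨hx, hxM⟩
      exact hZ this.1
    · rcases hZ'.1 hx with h | h
      · exact absurd h.2 hxM
      · exact h.1
  let d : Set ℕ × (Set ℕ → Q) :=
    ((A ∩ Iio M) ∪ (B \ Iio M), fun Z => if Z ⊆ B then h Z else f Z)
  have hdA : d.1 ⊆ A := hYinA
  have hdB : ∀ Z, Z ⊆ B → d.2 Z = h Z := fun Z hZ => if_pos hZ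
  have hdf : ∀ Z, ¬ Z ⊆ B → d.2 Z = f Z := fun Z hZ => if_neg hZ
  have hd : Ext le lt M (R i) (c (i + 1)) d := by
    refine ⟨⟨(hB.2.sdiff (finite_Iio M)).mono subset_union_right, ?_, ?_⟩,
      hdA.trans (hAsub _), ?_, ?_, ?_⟩
    · intro Z hZ
      by_cases hZB : Z ⊆ B
      · obtain ⟨n, hn⟩ := hh Z ⟨hZB, hZ.2⟩
        refine ⟨max n M, fun Z' hZ' e => ?_⟩
        have hZB' := hsubB Z Z' hZ' hZB (inter_Iio_of_le (le_max_right _ _) e)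
        rw [hdB _ hZB, hdB _ hZB']
        exact hn Z' ⟨hZB', hZ'.2⟩ (inter_Iio_of_le (le_max_left _ _) e)
      · obtain ⟨x, hxZ, hxB⟩ := not_subset.1 hZB
        obtain ⟨n, hn⟩ := hfloc Z (hZ.mono hdA)
        refine ⟨max n (x + 1), fun Z' hZ' e => ?_⟩
        have hx : x ∈ Z' ∩ Iio (x + 1) :=
          inter_Iio_of_le (le_max_right _ _) e ▸ ⟨hxZ, Nat.lt_succ_self x⟩
        rw [hdf _ hZB, hdf _ fun hc => hxB (hc hx.1)]
        exact hn Z' (hZ'.mono hdA) (inter_Iio_of_le (le_max_left _ _) e)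
    · intro Z hZ hle
      by_cases hZB : Z ⊆ B
      · rw [hdB _ hZB, hdB _ ((shift_subset Z).trans hZB)] at hle
        exact hbad Z ⟨hZB, hZ.2⟩ hle
      · rw [hdf _ hZB] at hle
        by_cases hsB : shift Z ⊆ B
        · rw [hdB _ hsB] at hle
          exact hfbad Z (hZ.mono hdA)
            (hmono _ _ _ hle (hlt _ ⟨hsB, hZ.shift.2⟩))
        · rw [hdf _ hsB] at hle
          exact hfbad Z (hZ.mono hdA) hle
    · rw [← hAN]
      refine Subset.antisymm (inter_subset_inter_left _ hdA) fun x hx => ⟨Or.inl hx, hx.2⟩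
    · intro Z hZ
      have h1 := hfle Z (hZ.mono hdA) (i + 1)
      by_cases hZB : Z ⊆ B
      · rw [hdB _ hZB]
        have h2 := hlt Z ⟨hZB, hZ.2⟩
        rcases h1 with h1 | h1
        · exact Or.inr (h1 ▸ h2)
        · exact Or.inr (htr _ _ _ h2 h1)
      · rwa [hdf _ hZB]
    · intro Z hZ hZR
      by_cases hZB : Z ⊆ B
      · exact absurd hZR (hnotR Z ⟨hZB, hZ.2⟩)
      · rw [hdf _ hZB]
        exact hf Z (hZ.mono hdA) _ (hRm (Nat.le_succ i) hZR)
  obtain ⟨Z, hZ, hZq⟩ := hq d hd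
  have hZB := hsubB Y Z hZ.1 hYB.1 hZ.2
  rw [hdB _ hZB] at hZq
  have h1 := hlt Z ⟨hZB, hZ.1.2⟩
  have h2 := hq' Z (node_mono (hdA.trans (hAsub _)) hZ)
  have h3 := hfle Z (hZ.1.mono hdA) (i + 1)
  rw [h2] at h3
  rw [hZq] at h1
  rcases h3 with h3 | h3
  · rw [h3] at h1; exact hwf.irrefl.irrefl _ h1
  · exact hwf.irrefl.irrefl _ (htr _ _ _ h1 h3)

end MinimalBadArray

open Relation Cardinal

universe w w'

variable {X : Type w}

theorem exists_forall_le_of_minimal {Q : Type*} {le : Q → Q → Prop} {B : Set ℕ}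
    (hB : B.Infinite) {h : Set ℕ → Q} (hh : LocConst B h)
    (hgood : ∀ C, InfSub B C → ¬ Bad le C h) :
    ∃ C, InfSub B C ∧ ∀ Y, InfSub C Y → le (h Y) (h (shift Y)) := by
  obtain ⟨C, hC, hP | hP⟩ := ramsey hB (hh.map₂ hh.shift le)
  · exact ⟨C, hC, hP⟩
  · exact absurd hP (hgood C hC)

/-! ### Embeddings between sets of quasi-ordered elements -/

/-- There is an injection of `L` into `L'` that is increasing for `r`. -/
def SetLe (r : X → X → Prop) (L L' : Set X) : Prop :=
  ∃ ι : X → X, InjOn ι L ∧ ∀ l ∈ L, ι l ∈ L' ∧ r l (ι l)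

section SetLe

variable {r : X → X → Prop} {L L' L'' M M' : Set X}

theorem SetLe.mono_right (h : SetLe r L L') (hL : L' ⊆ L'') : SetLe r L L'' :=
  let ⟨ι, h1, h2⟩ := h
  ⟨ι, h1, fun l hl => ⟨hL (h2 l hl).1, (h2 l hl).2⟩⟩

theorem SetLe.union (h : SetLe r L L') (h' : SetLe r M M') (hd : Disjoint L' M') :
    SetLe r (L ∪ M) (L' ∪ M') := by
  classical
  obtain ⟨ι, h1, h2⟩ := h
  obtain ⟨j, h3, h4⟩ := h'
  have hM : ∀ x ∈ L ∪ M, x ∉ L → x ∈ M := fun x hx hL => hx.resolve_left hL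
  refine ⟨fun x => if x ∈ L then ι x else j x, ?_, fun x hx => ?_⟩
  · intro x hx y hy e
    by_cases hxL : x ∈ L <;> by_cases hyL : y ∈ L <;> simp only [hxL, hyL, if_true, if_false] at e
    · exact h1 hxL hyL e
    · exact (disjoint_left.1 hd (h2 x hxL).1 (e ▸ (h4 y (hM y hy hyL)).1)).elim
    · exact (disjoint_left.1 hd (h2 y hyL).1 (e ▸ (h4 x (hM x hx hxL)).1)).elim
    · exact h3 (hM x hx hxL) (hM y hy hyL) e
  · by_cases hxL : x ∈ L <;> simp only [hxL, if_true, if_false]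
    · exact ⟨Or.inl (h2 x hxL).1, (h2 x hxL).2⟩
    · have := h4 x (hM x hx hxL)
      exact ⟨Or.inr this.1, this.2⟩

theorem SetLe.singleton {l l' : X} (h : r l l') : SetLe r {l} {l'} :=
  ⟨fun _ => l', by simp, by simpa using h⟩

theorem SetLe.of_sdiff_singleton {l l' : X} (hl : l ∈ L) (hl' : l' ∈ L') (h : r l l')
    (hs : SetLe r (L \ {l}) (L' \ {l'})) : SetLe r L L' := by
  have := (SetLe.singleton h).union hs disjoint_sdiff_right
  rwa [union_sdiff_cancel (singleton_subset_iff.2 hl),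
    union_sdiff_cancel (singleton_subset_iff.2 hl')] at this

theorem WQO.exists_finite_basis (h : WQO r L) :
    ∃ F ⊆ L, F.Finite ∧ ∀ l ∈ L, ∃ f ∈ F, r f l := by
  by_contra! hc
  obtain ⟨s, hs, hbad⟩ := exists_seq_of_forall_finset_exists (fun x => x ∈ L)
    (fun x y => ¬ r x y) (fun F hF => hc F hF F.finite_toSet)
  obtain ⟨i, j, hij, h⟩ := h s hs
  exact hbad i j hij h

/-- The elements of `L` with fewer than `#L` elements of `L` above them. -/
def small (r : X → X → Prop) (L : Set X) : Set X := {l ∈ L | #{m ∈ L | r l m} < #L}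

theorem small_subset : small r L ⊆ L := fun _ h => h.1

theorem mk_small_lt (h : WQO r L) (hL : L.Infinite) : #(small r L) < #L := by
  obtain ⟨F, hF, hfin, hb⟩ := (h.subset (small_subset (r := r))).exists_finite_basis
  have hL' : ℵ₀ ≤ #L := Cardinal.infinite_iff.1 hL.to_subtype
  have hsub : small r L ⊆ ⋃ f ∈ F, {m ∈ L | r f m} := fun l hl => by
    obtain ⟨f, hf, hr⟩ := hb l hl
    exact mem_iUnion₂.2 ⟨f, hf, hl.1, hr⟩
  refine (Cardinal.mk_le_mk_of_subset hsub).trans_lt ?_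
  clear hsub hb
  induction F, hfin using Set.Finite.induction_on with
  | empty => simpa using Cardinal.aleph0_pos.trans_le hL'
  | insert _ _ ih =>
    rw [biUnion_insert]
    exact (Cardinal.mk_union_le _ _).trans_lt
      (Cardinal.add_lt_of_lt hL' (hF (mem_insert _ _)).2 (ih ((subset_insert _ _).trans hF)))

theorem exists_injOn_choice (S : X → Set X) (h : ∀ l ∈ L, #L ≤ #(S l)) :
    ∃ ι : X → X, InjOn ι L ∧ ∀ l ∈ L, ι l ∈ S l := by
  classical
  obtain ⟨lt, wo, hlt⟩ := Cardinal.exists_ord_eq L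
  let F : L → X := wo.wf.fix fun l ih =>
    if h : ∃ x ∈ S l, ∀ m (hm : lt m l), ih m hm ≠ x then h.choose else l
  have hF : ∀ l, F l = if h : ∃ x ∈ S l, ∀ m (_ : lt m l), F m ≠ x then h.choose else (l : X) :=
    fun l => wo.wf.fix_eq _ l
  have hex : ∀ l : L, ∃ x ∈ S l, ∀ m (_ : lt m l), F m ≠ x := by
    intro l
    by_contra! hc
    have h1 : S l ⊆ F '' {m | lt m l} := fun x hx => by
      obtain ⟨m, hm, e⟩ := hc x hx
      exact ⟨m, hm, e⟩
    have h2 : #{m | lt m l} < #L := by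
      have := Ordinal.typein_lt_type lt l
      rw [← hlt, Cardinal.lt_ord] at this
      exact this
    exact absurd ((h l l.2).trans ((Cardinal.mk_le_mk_of_subset h1).trans Cardinal.mk_image_le))
      (not_le.2 h2)
  have hF' : ∀ l : L, F l ∈ S l ∧ ∀ m, lt m l → F m ≠ F l := fun l => by
    rw [hF l, dif_pos (hex l)]
    exact (hex l).choose_spec
  refine ⟨fun x => if hx : x ∈ L then F ⟨x, hx⟩ else x, fun x hx y hy e => ?_, fun x hx => ?_⟩
  · simp only [hx, hy, dif_pos] at e
    rcases trichotomous_of lt ⟨x, hx⟩ ⟨y, hy⟩ with h | h | h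
    · exact absurd e ((hF' _).2 _ h)
    · exact congrArg Subtype.val h
    · exact absurd e.symm ((hF' _).2 _ h)
  · simp only [hx, dif_pos]
    exact (hF' ⟨x, hx⟩).1

theorem SetLe.of_small (htr : ∀ a b c, r a b → r b c → r a c) (hw : WQO r L')
    (hinf : L'.Infinite) (hcard : #L ≤ #L') (hs : SetLe r (small r L) (small r L'))
    (hbig : ∀ l ∈ L \ small r L, ∃ l' ∈ L' \ small r L', r l l') : SetLe r L L' := by
  have hL' : ℵ₀ ≤ #L' := Cardinal.infinite_iff.1 hinf.to_subtype
  obtain ⟨ι, h1, h2⟩ := exists_injOn_choice (L := L \ small r L)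
    (fun l => {m ∈ L' | r l m} \ small r L') (fun l hl => by
      obtain ⟨l', hl', hr⟩ := hbig l hl
      refine (Cardinal.mk_le_mk_of_subset sdiff_subset).trans (hcard.trans ?_)
      by_contra! hc
      have h3 : {m ∈ L' | r l' m} ⊆ ({m ∈ L' | r l m} \ small r L') ∪ small r L' := by
        rintro m ⟨hm, hr'⟩
        by_cases hms : m ∈ small r L'
        · exact Or.inr hms
        · exact Or.inl ⟨⟨hm, htr _ _ _ hr hr'⟩, hms⟩
      refine hl'.2 ⟨hl'.1, ((Cardinal.mk_le_mk_of_subset h3).trans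
        (Cardinal.mk_union_le _ _)).trans_lt ?_⟩
      exact Cardinal.add_lt_of_lt hL' hc (mk_small_lt hw hinf))
  have h3 : SetLe r (L \ small r L) (L' \ small r L') :=
    ⟨ι, h1, fun l hl => ⟨⟨(h2 l hl).1.1, (h2 l hl).2⟩, (h2 l hl).1.2⟩⟩
  have := hs.union h3 disjoint_sdiff_right
  rwa [union_sdiff_cancel small_subset, union_sdiff_cancel small_subset] at this

/-- The lift of better-quasi-orders to sets with embeddings. -/
theorem not_bad_setLe (htr : ∀ a b c, r a b → r b c → r a c) {A : Set ℕ} (hA : A.Infinite)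
    {L : Set ℕ → Set X} (hL : LocConst A L)
    (hgood : ∀ B g, InfSub A B → LocConst B g → (∀ Y, InfSub B Y → g Y ∈ L Y) → ¬ Bad r B g)
    (hw : ∀ Y, InfSub A Y → WQO r (L Y)) : ¬ Bad (SetLe r) A L := by
  intro hbad
  obtain ⟨A', f, hA', hf, hfbad, hfL, hmin⟩ := exists_minimal_bad
    (lt := fun L M : Set X => L ⊆ M ∧ #L < #M)
    (Subrelation.wf (fun h => h.2) (InvImage.wf (fun L : Set X => #L) Cardinal.lt_wf))
    (fun _ _ _ h h' => ⟨h.1.trans h'.1, h.2.trans h'.2⟩)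
    (fun _ _ _ h h' => h.mono_right h'.1) hA hL hbad
  have hsub : ∀ Y, InfSub A' Y → f Y ⊆ L Y := fun Y hY =>
    (hfL Y hY).elim (fun h => h.subset) (fun h => h.1)
  have hne : ∀ Y, InfSub A' Y → (f Y).Nonempty := fun Y hY => by
    by_contra! hc
    refine hfbad Y hY ⟨id, ?_⟩
    rw [hc]
    simp
  obtain ⟨B, hB, hfin | hinf⟩ := ramsey hA'.2 (hf.map Set.Finite)
  · have hX : Nonempty X := ⟨(hne _ (InfSub.refl hA'.2)).some⟩
    have : ∃ e : Set X → X, ∀ S : Set X, S.Nonempty → e S ∈ S := by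
      choose! e he using fun (S : Set X) (h : S.Nonempty) => h
      exact ⟨e, he⟩
    obtain ⟨e, he⟩ := this
    have hm : ∀ Y, InfSub B Y → e (f Y) ∈ f Y := fun Y hY => he _ (hne Y (hY.mono hB.1))
    obtain ⟨C, hC, hCle⟩ := exists_forall_le_of_minimal (le := SetLe r) hB.2
      ((hf.mono hB.1).map fun S => S \ {e S}) fun C hC =>
        hmin C _ (hC.mono hB.1) ((hf.mono (hC.1.trans hB.1)).map fun S => S \ {e S})
          fun Y hY => ⟨sdiff_subset, by
            have hY' := hY.mono hC.1
            have h1 := hfin Y hY'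
            have : (f Y \ {e (f Y)}).encard < (f Y).encard :=
              (h1.sdiff).encard_lt_encard ⟨sdiff_subset, fun h => (h (hm Y hY')).2 rfl⟩
            have hcoe : #(f Y \ {e (f Y)} : Set X) ≤ #(f Y) :=
              Cardinal.mk_le_mk_of_subset sdiff_subset
            refine lt_of_le_of_ne hcoe fun h => this.ne ?_
            rw [← Set.toENat_cardinalMk, ← Set.toENat_cardinalMk, h]⟩
    refine hgood C _ (hC.mono (hB.1.trans hA'.1)) ((hf.mono (hC.1.trans hB.1)).map e)
      (fun Y hY => hsub Y (hY.mono (hC.1.trans hB.1)) (hm Y (hY.mono hC.1))) fun Y hY h => ?_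
    exact hfbad Y (hY.mono (hC.1.trans hB.1)) (SetLe.of_sdiff_singleton (hm Y (hY.mono hC.1))
      (hm _ (hY.mono hC.1).shift) h (hCle Y hY))
  · have hwf : ∀ Y, InfSub B Y → WQO r (f Y) := fun Y hY =>
      (hw Y (hY.mono (hB.1.trans hA'.1))).subset (hsub Y (hY.mono hB.1))
    obtain ⟨C, hC, hCle⟩ := exists_forall_le_of_minimal (le := SetLe r) hB.2
      ((hf.mono hB.1).map fun S => small r S) fun C hC =>
        hmin C _ (hC.mono hB.1) ((hf.mono (hC.1.trans hB.1)).map fun S => small r S)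
          fun Y hY => ⟨small_subset, mk_small_lt (hwf Y (hY.mono hC.1)) (hinf Y (hY.mono hC.1))⟩
    have hfC := hf.mono (hC.1.trans hB.1)
    obtain ⟨D, hD, hcard⟩ := exists_forall_le_of_minimal (le := (· ≤ ·)) hC.2
      (hfC.map fun S : Set X => #S) fun D hD hbad => not_descending_array Cardinal.lt_wf hD.2
        (fun Y => #(f Y)) fun Y hY => not_le.1 (hbad Y hY)
    have hDA := hD.1.trans (hC.1.trans hB.1)
    have hX : Nonempty X := ⟨(hne _ (InfSub.refl hA'.2)).some⟩
    have : ∃ e : Set X → Set X → X, ∀ S T : Set X,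
        (∃ l ∈ S \ small r S, ∀ l' ∈ T \ small r T, ¬ r l l') →
        e S T ∈ S \ small r S ∧ ∀ l' ∈ T \ small r T, ¬ r (e S T) l' := by
      choose! e he using fun (S T : Set X)
        (h : ∃ l ∈ S \ small r S, ∀ l' ∈ T \ small r T, ¬ r l l') => h
      exact ⟨e, he⟩
    obtain ⟨e, he⟩ := this
    have hg : ∀ Y, InfSub D Y → e (f Y) (f (shift Y)) ∈ f Y \ small r (f Y) ∧
        ∀ l' ∈ f (shift Y) \ small r (f (shift Y)), ¬ r (e (f Y) (f (shift Y))) l' := by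
      intro Y hY
      apply he
      by_contra! hc
      have hYB := hY.mono (hD.1.trans hC.1)
      exact hfbad Y (hY.mono hDA) (SetLe.of_small htr (hwf _ hYB.shift) (hinf _ hYB.shift)
        (hcard Y hY) (hCle Y (hY.mono hD.1)) hc)
    exact hgood D (fun Y => e (f Y) (f (shift Y))) (hD.mono (hC.1.trans (hB.1.trans hA'.1)))
      ((hf.mono hDA).map₂ (hf.mono hDA).shift e)
      (fun Y hY => hsub Y (hY.mono hDA) (hg Y hY).1.1)
      fun Y hY => (hg Y hY).2 _ (hg _ hY.shift).1

end SetLe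

/-! ### Embeddings of trees, coinductively -/

section Coalgebra

variable (ch : X → Set X)

/-- `y` can be reached from `x` by passing to children. -/
def Reach : X → X → Prop := ReflTransGen fun x y => y ∈ ch x

/-- `x` embeds into `y`, where the children of `x` go above distinct children of some element
reachable from `y`. -/
def EmbLE (x y : X) : Prop :=
  ∃ R : X → X → Prop,
    (∀ x y, R x y → ∃ y', Reach ch y y' ∧ SetLe R (ch x) (ch y')) ∧ R x y

variable {ch} {x y z : X}

theorem EmbLE.unfold (h : EmbLE ch x y) :
    ∃ y', Reach ch y y' ∧ SetLe (EmbLE ch) (ch x) (ch y') := by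
  obtain ⟨R, hR, h⟩ := h
  obtain ⟨y', h1, ι, h2, h3⟩ := hR x y h
  exact ⟨y', h1, ι, h2, fun l hl => ⟨(h3 l hl).1, R, hR, (h3 l hl).2⟩⟩

theorem EmbLE.refl (x : X) : EmbLE ch x x :=
  ⟨Eq, by rintro x _ rfl; exact ⟨x, .refl, id, injOn_id _, fun l hl => ⟨hl, rfl⟩⟩, rfl⟩

theorem EmbLE.exists_of_reach (h : EmbLE ch y z) {y' : X} (hy : Reach ch y y') :
    ∃ z', Reach ch z z' ∧ EmbLE ch y' z' := by
  induction hy with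
  | refl => exact ⟨z, .refl, h⟩
  | tail _ hc ih =>
    obtain ⟨z', h1, h2⟩ := ih
    obtain ⟨z'', h3, ι, -, h4⟩ := h2.unfold
    exact ⟨_, (ReflTransGen.trans h1 h3).tail (h4 _ hc).1, (h4 _ hc).2⟩

theorem EmbLE.of_reach {y' : X} (hy : Reach ch y y') (h : EmbLE ch x y') : EmbLE ch x y := by
  refine ⟨fun a b => ∃ b', Reach ch b b' ∧ EmbLE ch a b', ?_, y', hy, h⟩
  rintro a b ⟨b', h1, h2⟩
  obtain ⟨b'', h3, ι, h4, h5⟩ := h2.unfold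
  exact ⟨b'', ReflTransGen.trans h1 h3, ι, h4,
    fun l hl => ⟨(h5 l hl).1, _, .refl, (h5 l hl).2⟩⟩

theorem reach_embLE (h : Reach ch x y) : EmbLE ch y x := .of_reach h (.refl y)

theorem EmbLE.trans (h : EmbLE ch x y) (h' : EmbLE ch y z) : EmbLE ch x z := by
  refine ⟨fun a c => ∃ b, EmbLE ch a b ∧ EmbLE ch b c, ?_, y, h, h'⟩
  rintro a c ⟨b, h1, h2⟩
  obtain ⟨b', h3, ι, h4, h5⟩ := h1.unfold
  obtain ⟨c', h6, h7⟩ := h2.exists_of_reach h3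
  obtain ⟨c'', h8, j, h9, h10⟩ := h7.unfold
  exact ⟨c'', ReflTransGen.trans h6 h8, j ∘ ι, h9.comp h4 fun l hl => (h5 l hl).1,
    fun l hl => ⟨(h10 _ (h5 l hl).1).1, ι l, (h5 l hl).2, (h10 _ (h5 l hl).1).2⟩⟩

variable (ch) in
/-- The children of `y` into which `z` embeds. -/
def upper (y z : X) : Set X := {c ∈ ch y | EmbLE ch z c}

variable (ch) in
/-- The children of `y` into which `z` does not embed. -/
def lower (y z : X) : Set X := {c ∈ ch y | ¬ EmbLE ch z c}

theorem EmbLE.of_upper_lower {z' : X} (h : ∀ y, Reach ch z y → EmbLE ch z y →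
    ∃ y', Reach ch z' y' ∧ #(upper ch y z) ≤ #(upper ch y' z') ∧
      SetLe (EmbLE ch) (lower ch y z) (lower ch y' z')) : EmbLE ch z z' := by
  refine ⟨fun u v => (Reach ch z u ∧ EmbLE ch z u ∧ EmbLE ch z' v) ∨ EmbLE ch u v, ?_,
    Or.inl ⟨.refl, .refl z, .refl z'⟩⟩
  rintro u v (⟨h1, h2, h3⟩ | h1)
  swap
  · obtain ⟨v', h2, ι, h3, h4⟩ := h1.unfold
    exact ⟨v', h2, ι, h3, fun l hl => ⟨(h4 l hl).1, Or.inr (h4 l hl).2⟩⟩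
  obtain ⟨y', h4, h5, h6⟩ := h u h1 h2
  obtain ⟨v', h7, h8⟩ := h3.exists_of_reach h4
  obtain ⟨v'', h9, j, hj, hj'⟩ := h8.unfold
  refine ⟨v'', ReflTransGen.trans h7 h9, ?_⟩
  have hR : ∀ a b, (EmbLE ch z a ∧ EmbLE ch z' b ∨ EmbLE ch a b) → Reach ch z a →
      ∀ c, EmbLE ch b c →
      (Reach ch z a ∧ EmbLE ch z a ∧ EmbLE ch z' c) ∨ EmbLE ch a c := by
    rintro a b (⟨h1, h2⟩ | h1) hr c hc
    · exact Or.inl ⟨hr, h1, h2.trans hc⟩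
    · exact Or.inr (h1.trans hc)
  have key : SetLe (fun a b => EmbLE ch z a ∧ EmbLE ch z' b ∨ EmbLE ch a b) (ch u) (ch y') := by
    obtain ⟨ι, hι, hι'⟩ := exists_injOn_choice (L := upper ch u z) (fun _ => upper ch y' z')
      (fun _ _ => h5)
    obtain ⟨κ, hκ, hκ'⟩ := h6
    have e : ∀ y z : X, upper ch y z ∪ lower ch y z = ch y := fun y z => by
      ext c
      simp only [upper, lower, mem_union, mem_ofPred_eq]
      tauto
    rw [← e u z, ← e y' z']
    exact SetLe.union ⟨ι, hι, fun l hl => ⟨hι' l hl, Or.inl ⟨hl.2, (hι' l hl).2⟩⟩⟩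
      ⟨κ, hκ, fun l hl => ⟨(hκ' l hl).1, Or.inr (hκ' l hl).2⟩⟩
      (disjoint_left.2 fun c hc hc' => hc'.2 hc.2)
  obtain ⟨ι, hι, hι'⟩ := key
  refine ⟨j ∘ ι, hj.comp hι fun l hl => (hι' l hl).1, fun l hl => ⟨(hj' _ (hι' l hl).1).1, ?_⟩⟩
  exact hR l (ι l) (hι' l hl).2 (ReflTransGen.tail h1 hl) _ (hj' _ (hι' l hl).1).2

/-! ### Ranked elements are better-quasi-ordered -/

variable (ch) in
/-- `Rk α x` says that `x` has a version all of whose descendants are either above it or have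
smaller rank. -/
def IsRanking (Rk : Ordinal.{w'} → X → Prop) : Prop :=
  ∀ α x, Rk α x → ∃ z, EmbLE ch x z ∧ EmbLE ch z x ∧
    ∀ y, Reach ch z y → EmbLE ch z y ∨ ∃ β < α, Rk β y

variable (ch) in
/-- `y` embeds into `x` and has smaller rank. -/
def RankLT (Rk : Ordinal.{w'} → X → Prop) (y x : X) : Prop :=
  EmbLE ch y x ∧ (∃ α, Rk α y) ∧ (∃ α, Rk α x) ∧ sInf {α | Rk α y} < sInf {α | Rk α x}

variable {Rk : Ordinal.{w'} → X → Prop}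

theorem RankLT.trans (h : RankLT ch Rk x y) (h' : RankLT ch Rk y z) : RankLT ch Rk x z :=
  ⟨h.1.trans h'.1, h.2.1, h'.2.2.1, h.2.2.2.trans h'.2.2.2⟩

theorem wellFounded_rankLT : WellFounded (RankLT ch Rk) :=
  Subrelation.wf (fun h => h.2.2.2) (InvImage.wf (fun x => sInf {α | Rk α x}) Ordinal.lt_wf)

theorem IsRanking.exists_rep (hRk : IsRanking ch Rk) {x : X} (hx : ∃ α, Rk α x) :
    ∃ z, EmbLE ch x z ∧ EmbLE ch z x ∧
      ∀ y, Reach ch z y → ¬ EmbLE ch z y → RankLT ch Rk y x := by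
  obtain ⟨z, h1, h2, h3⟩ := hRk _ x (csInf_mem (s := {α | Rk α x}) hx)
  refine ⟨z, h1, h2, fun y hy hn => ?_⟩
  obtain ⟨β, hβ, hβy⟩ := (h3 y hy).resolve_left hn
  exact ⟨(reach_embLE hy).trans h2, ⟨β, hβy⟩, hx, (csInf_le' (s := {α | Rk α y}) hβy).trans_lt hβ⟩

theorem IsRanking.bqo_of_cones (hRk : IsRanking ch Rk) {D : Set X}
    (hD : ∀ x ∈ D, ∃ α, Rk α x) (hdown : ∀ x ∈ D, ∀ y, RankLT ch Rk y x → y ∈ D)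
    (hcone : ∀ x ∈ D, BQO (EmbLE ch) {y | RankLT ch Rk y x}) : BQO (EmbLE ch) D := by
  intro A₀ hA₀ f₀ hf₀ hf₀D hbad₀
  obtain ⟨A, f, hA, hf, hbad, hle, hmin⟩ := exists_minimal_bad wellFounded_rankLT
    (fun _ _ _ h h' => RankLT.trans h h') (fun _ _ _ h h' => h.trans h'.1) hA₀ hf₀ hbad₀
  have hfD : ∀ Y, InfSub A Y → f Y ∈ D := fun Y hY =>
    (hle Y hY).elim (fun h => h ▸ hf₀D Y (hY.mono hA.1))
      (fun h => hdown _ (hf₀D Y (hY.mono hA.1)) _ h)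
  have : ∃ ζ : X → X, ∀ x ∈ D, EmbLE ch x (ζ x) ∧ EmbLE ch (ζ x) x ∧
      ∀ y, Reach ch (ζ x) y → ¬ EmbLE ch (ζ x) y → RankLT ch Rk y x := by
    choose! ζ hζ using fun x (hx : x ∈ D) => hRk.exists_rep (hD x hx)
    exact ⟨ζ, hζ⟩
  obtain ⟨ζ, hζ⟩ := this
  have hX : Nonempty X := ⟨f A⟩
  have : ∃ η : X → X → X, ∀ z z', ¬ EmbLE ch z z' → Reach ch z (η z z') ∧ EmbLE ch z (η z z') ∧
      ∀ y', Reach ch z' y' → #(upper ch (η z z') z) ≤ #(upper ch y' z') →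
        ¬ SetLe (EmbLE ch) (lower ch (η z z') z) (lower ch y' z') := by
    have h : ∀ z z', ¬ EmbLE ch z z' → ∃ y, Reach ch z y ∧ EmbLE ch z y ∧
      ∀ y', Reach ch z' y' → #(upper ch y z) ≤ #(upper ch y' z') →
        ¬ SetLe (EmbLE ch) (lower ch y z) (lower ch y' z') := by
      intro z z' h
      by_contra! hc
      exact h (.of_upper_lower hc)
    choose! η hη using h
    exact ⟨η, hη⟩
  obtain ⟨η, hη⟩ := this
  let z : Set ℕ → X := fun Y => ζ (f Y)
  let y : Set ℕ → X := fun Y => η (z Y) (z (shift Y))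
  have hz : LocConst A z := hf.map ζ
  have hy : LocConst A y := hz.map₂ hz.shift η
  have hyz := fun Y (hY : InfSub A Y) => hη (z Y) (z (shift Y)) fun h =>
    hbad Y hY (((hζ _ (hfD Y hY)).1.trans h).trans (hζ _ (hfD _ hY.shift)).2.1)
  obtain ⟨B, hB, hcard⟩ := exists_forall_le_of_minimal (le := (· ≤ ·)) hA.2
    (hy.map₂ hz fun a b => #(upper ch a b)) fun B hB hbad => not_descending_array
      Cardinal.lt_wf hB.2 (fun Y => #(upper ch (y Y) (z Y))) fun Y hY => not_le.1 (hbad Y hY)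
  have hlow : ∀ Y, InfSub B Y → lower ch (y Y) (z Y) ⊆ {x | RankLT ch Rk x (f Y)} :=
    fun Y hY c hc => (hζ _ (hfD Y (hY.mono hB.1))).2.2 c
      ((hyz Y (hY.mono hB.1)).1.tail hc.1) hc.2
  refine not_bad_setLe (r := EmbLE ch) (fun _ _ _ h h' => h.trans h') hB.2
    (L := fun Y => lower ch (y Y) (z Y)) ((hy.map₂ hz (lower ch)).mono hB.1) ?_ ?_ ?_
  · intro C g hC hg hgL
    exact hmin C g (hC.mono hB.1) hg fun Y hY => hlow Y (hY.mono hC.1) (hgL Y hY)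
  · intro Y hY
    exact (hcone _ (hfD Y (hY.mono hB.1))).wqo.subset (hlow Y hY)
  · intro Y hY
    have hY' := hY.mono hB.1
    exact (hyz Y hY').2.2 _ (hyz _ hY'.shift).1 (hcard Y hY)

theorem IsRanking.bqo (hRk : IsRanking ch Rk) : BQO (EmbLE ch) {x | ∃ α, Rk α x} := by
  refine hRk.bqo_of_cones (fun _ h => h) (fun _ _ _ h => h.2.1) fun x hx => ?_
  clear hx
  induction x using (wellFounded_rankLT (ch := ch) (Rk := Rk)).induction with
  | _ x ih =>
    exact hRk.bqo_of_cones (fun y hy => hy.2.1) (fun y hy w hw => hw.trans hy)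
      fun y hy => ih y hy

end Coalgebra

/-! ### Counting classes of quasi-orders -/

section Counting

variable {Q : Type w'} {K : Type w} {r : Q → Q → Prop} {S : Set Q}

variable (K) in
/-- `S` has at most `#K` many classes up to the equivalence generated by `r`. -/
def Few (r : Q → Q → Prop) (S : Set Q) : Prop :=
  ∃ c : Q → K, ∀ a ∈ S, ∀ b ∈ S, c a = c b → r a b

theorem Few.of_code {C : Type w} (hC : #C ≤ #K) (c : Q → C)
    (h : ∀ a ∈ S, ∀ b ∈ S, c a = c b → r a b) : Few K r S := by
  obtain ⟨j⟩ := hC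
  exact ⟨fun a => j (c a), fun a ha b hb e => h a ha b hb (j.injective e)⟩

theorem mk_prod_self_le [Infinite K] : #(K × K) ≤ #K := by
  rw [Cardinal.mk_prod, Cardinal.lift_id, Cardinal.mul_eq_self (Cardinal.aleph0_le_mk K)]

theorem exists_injOn_Iio {o : Ordinal.{w'}} (h : Cardinal.lift.{w} o.card ≤ Cardinal.lift.{w'} #K)
    [Nonempty K] : ∃ e : Ordinal.{w'} → K, InjOn e (Iio o) := by
  classical
  have h' : Cardinal.lift.{w} #o.ToType ≤ Cardinal.lift.{w'} #K := by
    rwa [Cardinal.mk_toType]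
  obtain ⟨j⟩ := Cardinal.lift_mk_le'.1 h'
  refine ⟨fun β => if hβ : β ∈ Iio o then j (Ordinal.ToType.mk ⟨β, hβ⟩) else
    Classical.arbitrary K, fun β hβ γ hγ e => ?_⟩
  simp only [hβ, hγ, dif_pos] at e
  have := Ordinal.ToType.mk.injective (j.injective e)
  exact congrArg Subtype.val this

theorem exists_injOn_Iic [Infinite K] : ∃ e : Cardinal.{w} → K, InjOn e (Iic #K) := by
  have h : Cardinal.lift.{w} ((#K).ord + 1).card ≤ Cardinal.lift.{w} #K := by
    rw [Cardinal.lift_le, Ordinal.card_add_one, Cardinal.card_ord,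
      Cardinal.add_one_eq (Cardinal.aleph0_le_mk K)]
  obtain ⟨e, he⟩ := exists_injOn_Iio h
  refine ⟨fun c => e c.ord, fun a ha b hb h => ?_⟩
  have key : ∀ c ∈ Iic #K, c.ord ∈ Iio ((#K).ord + 1) := fun c hc =>
    Order.lt_add_one_iff.2 (Cardinal.ord_le_ord.2 hc)
  exact Cardinal.ord_injective (he (key a ha) (key b hb) h)

theorem Few.exists_downCode [Infinite K] (htr : ∀ a b c, r a b → r b c → r a c)
    (hw : WQO r S) (hf : Few K r S) :
    ∃ d : Set Q → K, ∀ A ⊆ S, ∀ B ⊆ S, d A = d B → ∀ a ∈ A, ∃ b ∈ B, r a b := by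
  classical
  obtain ⟨c, hc⟩ := hf
  have hN : ∀ A : Set Q, ∃ F : Finset Q, (F : Set Q) ⊆ {x ∈ S | ∀ a ∈ A, ¬ r x a} ∧
      ∀ x ∈ {x ∈ S | ∀ a ∈ A, ¬ r x a}, ∃ f ∈ F, r f x := fun A => by
    obtain ⟨F, h1, h2, h3⟩ := (hw.subset (sep_subset S _) :
      WQO r {x ∈ S | ∀ a ∈ A, ¬ r x a}).exists_finite_basis
    exact ⟨h2.toFinset, by simpa using h1, by simpa using h3⟩
  choose F hF hF' using hN
  obtain ⟨j⟩ := (Cardinal.mk_finset_of_infinite K).le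
  refine ⟨fun A => j ((F A).image c), fun A hA B hB e a ha => ?_⟩
  by_contra! hc'
  obtain ⟨f, hf, hr⟩ := hF' B a ⟨hA ha, hc'⟩
  have h1 : c f ∈ (F A).image c := j.injective e ▸ Finset.mem_image_of_mem c hf
  obtain ⟨g, hg, hgf⟩ := Finset.mem_image.1 h1
  exact (hF A hg).2 a ha (htr _ _ _ (hc g (hF A hg).1 f (hF B hf).1 hgf) hr)

end Counting

section CountingSets

variable {X : Type w} {K : Type w} [Infinite K] {r : X → X → Prop} {D : Set X}

theorem Few.of_forall_mk_eq {M : Set Cardinal.{w}} (hM : M ⊆ Iic #K)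
    (h : ∀ μ ∈ M, Few K (SetLe r) {L | L ⊆ D ∧ #L = μ}) :
    Few K (SetLe r) {L | L ⊆ D ∧ #L ∈ M} := by
  obtain ⟨e, he⟩ := exists_injOn_Iic (K := K)
  choose! c hc using h
  refine .of_code mk_prod_self_le (fun L => (e #L, c #L L)) fun L hL L' hL' h => ?_
  have h1 : #L = #L' := he (hM hL.2) (hM hL'.2) (congrArg Prod.fst h)
  refine hc #L hL.2 L ⟨hL.1, rfl⟩ L' ⟨hL'.1, h1.symm⟩ ?_
  have h2 := congrArg Prod.snd h
  simpa only [← h1] using h2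

theorem Few.setLe_of_mk_eq (htr : ∀ a b c, r a b → r b c → r a c) (hw : WQO r D)
    (hf : Few K r D) (μ : Cardinal.{w}) (hμ : μ ≤ #K) :
    Few K (SetLe r) {L | L ⊆ D ∧ #L = μ} := by
  induction μ using Cardinal.lt_wf.induction with
  | _ μ ih =>
  obtain ⟨code, hcode⟩ := Few.of_forall_mk_eq (M := Iio μ)
    (fun ν hν => (le_of_lt hν).trans hμ) fun ν hν => ih ν hν ((le_of_lt hν).trans hμ)
  rcases lt_or_ge μ ℵ₀ with hfin | hinf
  · obtain ⟨c, hc⟩ := hf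
    have : ∃ e : Set X → Option X, ∀ L : Set X, (∀ l, e L = some l → l ∈ L) ∧
        (e L = none → L = ∅) := by
      have h : ∀ L : Set X, ∃ o : Option X, (∀ l, o = some l → l ∈ L) ∧ (o = none → L = ∅) := by
        intro L
        rcases L.eq_empty_or_nonempty with h | ⟨l, hl⟩
        · exact ⟨none, by simp, fun _ => h⟩
        · exact ⟨some l, by simpa using hl, by simp⟩
      choose e he using h
      exact ⟨e, he⟩
    obtain ⟨e, he⟩ := this
    refine .of_code (C := Option (K × K)) (by
      rw [Cardinal.mk_option]
      exact Cardinal.add_le_of_le (Cardinal.aleph0_le_mk K) mk_prod_self_le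
        (Cardinal.one_le_aleph0.trans (Cardinal.aleph0_le_mk K)))
      (fun L => (e L).map fun l => (c l, code (L \ {l}))) fun L hL L' hL' h => ?_
    have hlt : ∀ L : Set X, #L = μ → ∀ l ∈ L, #(L \ {l} : Set X) < μ := by
      intro L hL l hl
      have hLf : L.Finite := Cardinal.lt_aleph0_iff_set_finite.1 (hL ▸ hfin)
      rw [← hL]
      refine lt_of_le_of_ne (Cardinal.mk_le_mk_of_subset sdiff_subset) fun h => ?_
      have : (L \ {l}).encard < L.encard :=
        hLf.sdiff.encard_lt_encard ⟨sdiff_subset, fun h => (h hl).2 rfl⟩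
      exact this.ne (by rw [← Set.toENat_cardinalMk, ← Set.toENat_cardinalMk, h])
    rcases hl : e L with _ | l <;> rcases hl' : e L' with _ | l' <;>
      simp only [hl, hl', Option.map_none, Option.map_some, reduceCtorEq, Option.some.injEq,
        Prod.mk.injEq] at h
    · rw [(he L).2 hl]
      exact ⟨id, by simp, by simp⟩
    · have h1 := (he L).1 l hl
      have h1' := (he L').1 l' hl'
      exact .of_sdiff_singleton h1 h1' (hc l (hL.1 h1) l' (hL'.1 h1') h.1)
        (hcode _ ⟨sdiff_subset.trans hL.1, hlt L hL.2 l h1⟩ _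
          ⟨sdiff_subset.trans hL'.1, hlt L' hL'.2 l' h1'⟩ h.2)
  · obtain ⟨d, hd⟩ := hf.exists_downCode htr hw
    have hinf' : ∀ L : Set X, #L = μ → L.Infinite := fun L hL =>
      Set.infinite_coe_iff.1 (Cardinal.infinite_iff.2 (hL ▸ hinf))
    refine .of_code mk_prod_self_le (fun L => (code (small r L), d (L \ small r L)))
      fun L hL L' hL' h => ?_
    have hs : ∀ L : Set X, L ⊆ D → #L = μ → #(small r L) < μ := fun L hL hLμ =>
      hLμ ▸ mk_small_lt (hw.subset hL) (hinf' L hLμ)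
    exact .of_small htr (hw.subset hL'.1) (hinf' L' hL'.2) (hL.2.trans hL'.2.symm).le
      (hcode _ ⟨small_subset.trans hL.1, hs L hL.1 hL.2⟩ _
        ⟨small_subset.trans hL'.1, hs L' hL'.1 hL'.2⟩ (congrArg Prod.fst h))
      (hd _ (sdiff_subset.trans hL.1) _ (sdiff_subset.trans hL'.1) (congrArg Prod.snd h))

theorem Few.setLe (htr : ∀ a b c, r a b → r b c → r a c) (hw : WQO r D)
    (hf : Few K r D) : Few K (SetLe r) {L | L ⊆ D ∧ #L ≤ #K} :=
  .of_forall_mk_eq (M := Iic #K) Subset.rfl fun μ hμ => hf.setLe_of_mk_eq htr hw μ hμ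

/-- The product of the orders on cardinals and on sets. -/
def CardSetLe (r : X → X → Prop) (p q : Cardinal.{w} × Set X) : Prop :=
  p.1 ≤ q.1 ∧ SetLe r p.2 q.2

theorem SetLe.trans (htr : ∀ a b c, r a b → r b c → r a c) {L M N : Set X} (h : SetLe r L M)
    (h' : SetLe r M N) : SetLe r L N := by
  obtain ⟨ι, h1, h2⟩ := h
  obtain ⟨j, h3, h4⟩ := h'
  exact ⟨j ∘ ι, h3.comp h1 fun l hl => (h2 l hl).1,
    fun l hl => ⟨(h4 _ (h2 l hl).1).1, htr _ _ _ (h2 l hl).2 (h4 _ (h2 l hl).1).2⟩⟩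

theorem BQO.cardSetLe (htr : ∀ a b c, r a b → r b c → r a c) (h : BQO r D) :
    BQO (CardSetLe r) {p | p.2 ⊆ D} := by
  intro A hA f hf hfD hbad
  obtain ⟨B, hB, hcard⟩ := exists_forall_le_of_minimal (le := (· ≤ ·)) hA
    (hf.map Prod.fst) fun B hB hbad => not_descending_array
      Cardinal.lt_wf hB.2 (fun Y => (f Y).1) fun Y hY => not_le.1 (hbad Y hY)
  refine not_bad_setLe htr hB.2 ((hf.mono hB.1).map Prod.snd) (fun C g hC hg hgL => ?_)
    (fun Y hY => h.wqo.subset (hfD Y (hY.mono hB.1)))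
    fun Y hY hle => hbad Y (hY.mono hB.1) ⟨hcard Y hY, hle⟩
  exact h C hC.2 g hg fun Y hY => hfD Y (hY.mono (hC.1.trans hB.1)) (hgL Y hY)

end CountingSets

theorem IsRanking.few {X K : Type w} [Infinite K] {ch : X → Set X} (hch : ∀ x, #(ch x) ≤ #K)
    {Rk : Ordinal.{w'} → X → Prop} (hRk : IsRanking ch Rk) (α : Ordinal.{w'})
    (hα : ∃ e : Ordinal.{w'} → K, InjOn e (Iio α)) : Few K (EmbLE ch) {x | Rk α x} := by
  induction α using Ordinal.lt_wf.induction with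
  | _ α ih =>
  have htr : ∀ a b c : X, EmbLE ch a b → EmbLE ch b c → EmbLE ch a c := fun _ _ _ => EmbLE.trans
  obtain ⟨e, he⟩ := hα
  replace ih := fun β (hβ : β < α) => ih β hβ ⟨e, he.mono (Iio_subset_Iio hβ.le)⟩
  have hbqo : BQO (EmbLE ch) {x | ∃ β < α, Rk β x} :=
    hRk.bqo.subset fun x ⟨β, _, h⟩ => ⟨β, h⟩
  have hfew : Few K (EmbLE ch) {x | ∃ β < α, Rk β x} := by
    choose! c hc using ih
    choose! b hb using fun x (hx : x ∈ {x | ∃ β < α, Rk β x}) => hx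
    refine .of_code mk_prod_self_le (fun x => (e (b x), c (b x) x)) fun x hx y hy h => ?_
    have h1 : b x = b y := he (hb x hx).1 (hb y hy).1 (congrArg Prod.fst h)
    refine hc (b x) (hb x hx).1 x (hb x hx).2 y (by rw [h1]; exact (hb y hy).2) ?_
    have h2 := congrArg Prod.snd h
    simpa only [← h1] using h2
  have hfew' : Few K (CardSetLe (EmbLE ch))
      {p | p.1 ≤ #K ∧ p.2 ⊆ {x | ∃ β < α, Rk β x} ∧ #p.2 ≤ #K} := by
    obtain ⟨j, hj⟩ := exists_injOn_Iic (K := K)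
    obtain ⟨c, hc⟩ := hfew.setLe htr hbqo.wqo
    refine .of_code mk_prod_self_le (fun p => (j p.1, c p.2)) fun p hp q hq h => ?_
    exact ⟨(hj hp.1 hq.1 (congrArg Prod.fst h)).le,
      hc _ hp.2 _ hq.2 (congrArg Prod.snd h)⟩
  obtain ⟨d, hd⟩ := hfew'.exists_downCode (fun _ _ _ h h' => ⟨h.1.trans h'.1, h.2.trans htr h'.2⟩)
    ((hbqo.cardSetLe htr).wqo.subset fun p hp => hp.2.1)
  choose! ζ hζ1 hζ2 hζ3 using fun x (hx : Rk α x) => hRk α x hx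
  let Φ : X → Set (Cardinal.{w} × Set X) := fun x =>
    (fun y => (#(upper ch y (ζ x)), lower ch y (ζ x))) '' {y | Reach ch (ζ x) y ∧ EmbLE ch (ζ x) y}
  have hΦ : ∀ x, Rk α x →
      Φ x ⊆ {p | p.1 ≤ #K ∧ p.2 ⊆ {x | ∃ β < α, Rk β x} ∧ #p.2 ≤ #K} := by
    rintro x hx _ ⟨y, hy, rfl⟩
    exact ⟨(Cardinal.mk_le_mk_of_subset (sep_subset _ _)).trans (hch y),
      fun c hc => (hζ3 x hx c (hy.1.tail hc.1)).resolve_left hc.2,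
      (Cardinal.mk_le_mk_of_subset (sep_subset _ _)).trans (hch y)⟩
  refine ⟨fun x => d (Φ x), fun x hx x' hx' h => ?_⟩
  refine ((hζ1 x hx).trans (.of_upper_lower fun y hy hy' => ?_)).trans (hζ2 x' hx')
  obtain ⟨_, ⟨y', hy1, rfl⟩, h1, h2⟩ := hd _ (hΦ x hx) _ (hΦ x' hx') h _ ⟨y, ⟨hy, hy'⟩, rfl⟩
  exact ⟨y', hy1.1, h1, h2⟩

/-! ### The tree-order -/

section TreeOrder

variable {V : Type*} {G : SimpleGraph V} {r a b c d w : V}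

/-- `b` is a child of `a` in the tree `G` rooted at `r`. -/
def Child (G : SimpleGraph V) (r a b : V) : Prop := G.Adj a b ∧ treeLE G r a b

theorem isPath_unique (hG : G.IsTree) {p q : G.Walk a b} (hp : p.IsPath) (hq : q.IsPath) : p = q :=
  (hG.existsUnique_path a b).unique hp hq

theorem exists_isPath (hG : G.IsTree) (a b : V) : ∃ p : G.Walk a b, p.IsPath :=
  (hG.existsUnique_path a b).exists

theorem treeLE_iff (hG : G.IsTree) {p : G.Walk r b} (hp : p.IsPath) :
    treeLE G r a b ↔ a ∈ p.support :=
  ⟨fun ⟨_, hq, h⟩ => isPath_unique hG hq hp ▸ h, fun h => ⟨p, hp, h⟩⟩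

theorem treeLE_refl (hG : G.IsTree) (r a : V) : treeLE G r a a :=
  let ⟨p, hp⟩ := exists_isPath hG r a
  ⟨p, hp, p.end_mem_support⟩

theorem treeLE_root (hG : G.IsTree) (r a : V) : treeLE G r r a :=
  let ⟨p, hp⟩ := exists_isPath hG r a
  ⟨p, hp, p.start_mem_support⟩

theorem treeLE_trans (hG : G.IsTree) (hab : treeLE G r a b) (hbc : treeLE G r b c) :
    treeLE G r a c := by
  classical
  obtain ⟨p, hp, hb⟩ := hbc
  exact ⟨p, hp, p.support_takeUntil_subset_support hb ((treeLE_iff hG (hp.takeUntil hb)).1 hab)⟩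

theorem treeLE_antisymm (hG : G.IsTree) (hab : treeLE G r a b) (hba : treeLE G r b a) : a = b := by
  classical
  by_contra hne
  obtain ⟨p, hp, ha⟩ := hab
  have hb := (treeLE_iff hG (hp.takeUntil ha)).1 hba
  have h1 := isPath_unique hG ((hp.takeUntil ha).takeUntil hb) hp
  have h2 := SimpleGraph.Walk.length_takeUntil_lt_length ha hne
  have h3 := SimpleGraph.Walk.length_takeUntil_le_length (p.takeUntil a ha) hb
  rw [h1] at h3
  omega

theorem treeLE_or_of_adj (hG : G.IsTree) (r : V) (h : G.Adj a b) :
    treeLE G r a b ∨ treeLE G r b a := by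
  obtain ⟨p, hp⟩ := exists_isPath hG r a
  by_cases hb : b ∈ p.support
  · exact .inr ⟨p, hp, hb⟩
  · exact .inl ⟨p.concat h, hp.concat hb h, by simp [SimpleGraph.Walk.support_concat]⟩

theorem child_or_of_adj (hG : G.IsTree) (r : V) (h : G.Adj a b) :
    Child G r a b ∨ Child G r b a :=
  (treeLE_or_of_adj hG r h).imp (⟨h, ·⟩) (⟨h.symm, ·⟩)

theorem Child.ne (h : Child G r a b) : a ≠ b := h.1.ne

theorem Child.not_le (hG : G.IsTree) (h : Child G r a b) : ¬ treeLE G r b a :=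
  fun h' => h.ne (treeLE_antisymm hG h.2 h')

theorem Child.le_of_le (hG : G.IsTree) (h : Child G r a b) (hw : treeLE G r w b) (hne : w ≠ b) :
    treeLE G r w a := by
  obtain ⟨p, hp⟩ := exists_isPath hG r a
  have hb : b ∉ p.support := fun hb => h.not_le hG ⟨p, hp, hb⟩
  have := (treeLE_iff hG (hp.concat hb h.1)).1 hw
  rw [SimpleGraph.Walk.support_concat] at this
  exact ⟨p, hp, by simpa [hne] using this⟩

theorem Child.parent_unique (hG : G.IsTree) (h : Child G r a c) (h' : Child G r b c) : a = b :=
  treeLE_antisymm hG (h'.le_of_le hG h.2 h.ne) (h.le_of_le hG h'.2 h'.ne)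

theorem treeLE_iff_reflTransGen (hG : G.IsTree) :
    treeLE G r a b ↔ ReflTransGen (Child G r) a b := by
  refine ⟨fun ⟨p, hp, ha⟩ => ?_, fun h => ?_⟩
  · rename_i h0
    clear h0
    induction p using SimpleGraph.Walk.concatRec with
    | Hnil => simp_all [ReflTransGen.refl]
    | Hconcat p h ih =>
      have hpp : p.IsPath := by
        rw [SimpleGraph.Walk.concat_eq_append] at hp
        exact hp.of_append_left
      rw [SimpleGraph.Walk.support_concat] at ha
      rw [List.mem_append] at ha
      rcases ha with ha | ha
      · exact (ih hpp ha).tail ⟨h, _, hp, by simp [SimpleGraph.Walk.support_concat]⟩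
      · simp_all [ReflTransGen.refl]
  · induction h with
    | refl => exact treeLE_refl hG r a
    | tail _ h ih => exact treeLE_trans hG ih h.2

theorem treeLE_or_treeLE (hG : G.IsTree) (ha : treeLE G r a w) (hb : treeLE G r b w) :
    treeLE G r a b ∨ treeLE G r b a := by
  have ha' := ha
  rw [treeLE_iff_reflTransGen hG] at ha'
  induction ha' with
  | refl => exact .inr hb
  | @tail _ c h h' ih =>
    by_cases hne : b = c
    · exact .inl (hne ▸ ha)
    · exact ih ((treeLE_iff_reflTransGen hG).2 h) (h'.le_of_le hG hb hne)

theorem exists_child_le (hG : G.IsTree) (h : treeLE G r a b) (hne : a ≠ b) :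
    ∃ d, Child G r a d ∧ treeLE G r d b := by
  rcases ((treeLE_iff_reflTransGen hG).1 h).cases_head with h | ⟨d, h1, h2⟩
  · exact absurd h hne
  · exact ⟨d, h1, (treeLE_iff_reflTransGen hG).2 h2⟩

theorem Child.le_of_le_of_le (hG : G.IsTree) (h : Child G r a d) (hab : treeLE G r a b)
    (hne : a ≠ b) (hd : treeLE G r d w) (hb : treeLE G r b w) : treeLE G r d b := by
  rcases treeLE_or_treeLE hG hd hb with h' | h'
  · exact h'
  · by_cases hbd : b = d
    · exact hbd ▸ treeLE_refl hG r b
    · exact absurd (treeLE_antisymm hG hab (h.le_of_le hG h' hbd)) hne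

theorem Child.eq_of_le (hG : G.IsTree) (h : Child G r a c) (h' : Child G r a d)
    (hc : treeLE G r c w) (hd : treeLE G r d w) : c = d :=
  treeLE_antisymm hG (h.le_of_le_of_le hG h'.2 h'.ne hc hd)
    (h'.le_of_le_of_le hG h.2 h.ne hd hc)

theorem wellFounded_child (hG : G.IsTree) (r : V) : WellFounded (Child G r) := by
  refine ⟨fun b => ?_⟩
  induction (treeLE_iff_reflTransGen hG).1 (treeLE_root hG r b) with
  | refl => exact ⟨_, fun a h => absurd (treeLE_root hG r a) (h.not_le hG)⟩
  | tail _ h ih => exact ⟨_, fun a h' => h'.parent_unique hG h ▸ ih⟩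

theorem mem_support_iff (hG : G.IsTree) (h : treeLE G r a b) {p : G.Walk a b} (hp : p.IsPath) :
    w ∈ p.support ↔ treeLE G r a w ∧ treeLE G r w b := by
  classical
  obtain ⟨q, hq, ha⟩ := h
  have hpq : p = q.dropUntil a ha := isPath_unique hG hp (hq.dropUntil ha)
  constructor
  · intro hw
    refine ⟨?_, q, hq, ?_⟩
    · have h1 : ((q.takeUntil a ha).append (p.takeUntil w hw)).IsPath := by
        refine SimpleGraph.Walk.IsPath.of_append_left (q := p.dropUntil w hw) ?_
        rwa [← SimpleGraph.Walk.append_assoc, SimpleGraph.Walk.take_spec, hpq,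
          SimpleGraph.Walk.take_spec]
      exact ⟨_, h1, by simp [SimpleGraph.Walk.mem_support_append_iff]⟩
    · exact q.support_dropUntil_subset_support ha (hpq ▸ hw)
  · rintro ⟨h1, h2⟩
    have hw := (treeLE_iff hG hq).1 h2
    have ha' := (treeLE_iff hG (hq.takeUntil hw)).1 h1
    have h3 : (((q.takeUntil w hw).dropUntil a ha').append (q.dropUntil w hw)).IsPath := by
      refine SimpleGraph.Walk.IsPath.of_append_right (p := (q.takeUntil w hw).takeUntil a ha') ?_
      rwa [SimpleGraph.Walk.append_assoc, SimpleGraph.Walk.take_spec, SimpleGraph.Walk.take_spec]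
    rw [isPath_unique hG hp h3]
    simp [SimpleGraph.Walk.mem_support_append_iff]

end TreeOrder

/-! ### Embeddings of rooted trees from and to child-wise embeddings -/

section Embedding

variable {V : Type u} {W : Type v} {T : RootedGraph V} {S : RootedGraph W}

theorem exists_injOn_child (hS : S.graph.IsTree)
    (e : TopMinorEmb T.graph S.graph)
    (he : ∀ x y, treeLE T.graph T.root x y → treeLE S.graph S.root (e.toFun x) (e.toFun y)) (x : V) :
    ∃ f : V → W, InjOn f {c | Child T.graph T.root x c} ∧ ∀ c, Child T.graph T.root x c →
      Child S.graph S.root (e.toFun x) (f c) ∧ treeLE S.graph S.root (f c) (e.toFun c) := by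
  have : Nonempty W := ⟨S.root⟩
  choose! f hf hf' using fun c (hc : Child T.graph T.root x c) =>
    exists_child_le hS (he x c hc.2) (e.inj.ne hc.ne)
  refine ⟨f, fun c hc c' hc' h => ?_, fun c hc => ⟨hf c hc, hf' c hc⟩⟩
  by_contra hne
  have hmem : ∀ c (hc : Child T.graph T.root x c), f c ∈ (e.path hc.1).support := fun c hc =>
    (mem_support_iff hS (he x c hc.2) (e.path_isPath hc.1)).2 ⟨(hf c hc).2, hf' c hc⟩
  have hs : s(x, c) ≠ s(x, c') := by simp [hne, hc.ne.symm]
  have h1 := (e.internally_disjoint hc.1 hc'.1 hs _ (hmem c hc) (h ▸ hmem c' hc')).resolve_left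
    (hf c hc).ne.symm
  have h2 := (e.internally_disjoint hc'.1 hc.1 hs.symm _ (hmem c' hc')
    (h ▸ hmem c hc)).resolve_left (hf c' hc').ne.symm
  exact hne (e.inj (h1.symm.trans (h.trans h2)))

/-- A map `φ` is a topological embedding if, for some choice of `base x` below `φ x`, it
sends the subtrees at the children of a vertex `x` into the subtrees at distinct children of
`φ x`. -/
theorem rootedLE_of_child (hT : T.graph.IsTree) (hS : S.graph.IsTree) (base φ : V → W)
    (hbase : ∀ x, treeLE S.graph S.root (base x) (φ x))
    (hchild : ∀ x c, Child T.graph T.root x c → Child S.graph S.root (φ x) (base c))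
    (hinj : ∀ x, InjOn base {c | Child T.graph T.root x c}) : RootedLE T S := by
  have hmono : ∀ x y, treeLE T.graph T.root x y → treeLE S.graph S.root (φ x) (φ y) := by
    intro x y h
    induction (treeLE_iff_reflTransGen hT).1 h with
    | refl => exact treeLE_refl hS _ _
    | tail h1 h2 ih =>
      exact treeLE_trans hS (ih ((treeLE_iff_reflTransGen hT).2 h1))
        (treeLE_trans hS (hchild _ _ h2).2 (hbase _))
  have hrefl : ∀ x y, treeLE S.graph S.root (base x) (φ y) → treeLE T.graph T.root x y := by
    intro x y
    induction (treeLE_iff_reflTransGen hT).1 (treeLE_root hT T.root x) with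
    | refl => exact fun _ => treeLE_root hT _ _
    | @tail x c _ h ih =>
      intro hc
      have hxy := ih (treeLE_trans hS (hbase x) (treeLE_trans hS (hchild x c h).2 hc))
      by_cases hne : x = y
      · exact absurd (hne ▸ hc) ((hchild x c h).not_le hS)
      · obtain ⟨d, hd, hdy⟩ := exists_child_le hT hxy hne
        have := (hchild x c h).eq_of_le hS (hchild x d hd) hc
          (treeLE_trans hS (hbase d) (hmono d y hdy))
        exact hinj x h hd this ▸ hdy
  have hreflφ : ∀ x y, treeLE S.graph S.root (φ x) (φ y) → treeLE T.graph T.root x y :=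
    fun x y h => hrefl x y (treeLE_trans hS (hbase x) h)
  have hφ : Function.Injective φ := fun x y h => treeLE_antisymm hT
    (hreflφ x y (h ▸ treeLE_refl hS _ _)) (hreflφ y x (h ▸ treeLE_refl hS _ _))
  choose P hP using fun x y => exists_isPath hS (φ x) (φ y)
  have hsupp : ∀ a b w, T.graph.Adj a b → w ∈ (P a b).support → ∃ a' b',
      Child T.graph T.root a' b' ∧ (∀ a'' b'', s(a, b) ≠ s(a'', b'') → s(a', b') ≠ s(a'', b'')) ∧
      (w = φ a' ∨ w = φ b' → w = φ a ∨ w = φ b) ∧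
      treeLE S.graph S.root (φ a') w ∧ treeLE S.graph S.root w (φ b') := by
    intro a b w h hw
    rcases child_or_of_adj hT T.root h with h | h
    · exact ⟨a, b, h, fun _ _ => id, id, (mem_support_iff hS (hmono a b h.2) (hP a b)).1 hw⟩
    · refine ⟨b, a, h, fun _ _ h => Sym2.eq_swap ▸ h, Or.symm,
        (mem_support_iff hS (hmono b a h.2) (hP a b).reverse).1 ?_⟩
      simpa using hw
  refine ⟨⟨φ, hφ, fun a b _ => P a b, fun a b _ => hP a b,
    fun a b h => isPath_unique hS (hP b a) (hP a b).reverse, ?_, ?_⟩, hmono⟩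
  · rintro a b h w hw hwa hwb x rfl
    obtain ⟨a', b', h', -, himp, h1, h2⟩ := hsupp a b _ h hw
    have hab : x = a' ∨ x = b' := by
      by_cases hb : x = b'
      · exact .inr hb
      · exact .inl (treeLE_antisymm hT (h'.le_of_le hT (hreflφ _ _ h2) hb) (hreflφ _ _ h1))
    rcases himp (hab.imp (congrArg φ) (congrArg φ)) with h | h
    · exact hwa h
    · exact hwb h
  · intro a b c d h h' hne w hw hw'
    obtain ⟨a₁, b₁, h₁, hne₁, himp, ha₁, hb₁⟩ := hsupp a b w h hw
    obtain ⟨a₂, b₂, h₂, hne₂, -, ha₂, hb₂⟩ := hsupp c d w h' hw'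
    have hne' := hne₂ _ _ (hne₁ _ _ hne).symm
    apply himp
    by_contra! hc
    have hlow : ∀ a b, Child T.graph T.root a b → treeLE S.graph S.root (φ a) w →
        treeLE S.graph S.root w (φ b) → w ≠ φ a → treeLE S.graph S.root (base b) w :=
      fun a b h h1 h2 h3 => (hchild a b h).le_of_le_of_le hS h1 h3.symm (hbase b) h2
    have h3 := hlow a₁ b₁ h₁ ha₁ hb₁ hc.1
    by_cases hw₂ : w = φ a₂
    · subst hw₂
      exact hc.2 (congrArg φ (treeLE_antisymm hT (hreflφ _ _ hb₁) (hrefl _ _ h3)))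
    · have hbb := treeLE_antisymm hT (hrefl _ _ (treeLE_trans hS h3 hb₂))
        (hrefl _ _ (treeLE_trans hS (hlow a₂ b₂ h₂ ha₂ hb₂ hw₂) hb₁))
      subst hbb
      exact hne' (by rw [h₁.parent_unique hT h₂])

end Embedding

/-! ### Subtrees -/

section Subtree

variable {V : Type u} {T : RootedGraph V}

theorem mem_upSet (hT : T.graph.IsTree) {t s : V} : s ∈ upSet T t ↔ treeLE T.graph T.root t s :=
  ⟨fun h => h.elim (fun h => h ▸ treeLE_refl hT _ _) id, .inr⟩

theorem isPath_induce {G : SimpleGraph V} {s : Set V} {a b : V} {p : G.Walk a b} (hp : p.IsPath)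
    (hs : ∀ w ∈ p.support, w ∈ s) : (p.induce s hs).IsPath := by
  refine SimpleGraph.Walk.IsPath.of_map (f := (SimpleGraph.Embedding.induce s).toHom) ?_
  rwa [SimpleGraph.Walk.map_induce]

theorem mem_support_induce {G : SimpleGraph V} {s : Set V} {a b : V} {p : G.Walk a b}
    (hs : ∀ w ∈ p.support, w ∈ s) {x : s} : x ∈ (p.induce s hs).support ↔ (x : V) ∈ p.support := by
  simp [SimpleGraph.Walk.support_induce]

theorem exists_isPath_subtreeAt (hT : T.graph.IsTree) (t : V) (b : upSet T t) :
    ∃ p : (subtreeAt T t).graph.Walk (subtreeAt T t).root b, p.IsPath ∧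
      ∀ a : upSet T t, a ∈ p.support ↔ treeLE T.graph T.root a b := by
  obtain ⟨p, hp⟩ := exists_isPath hT t b
  have hsupp := fun w => mem_support_iff (w := w) hT ((mem_upSet hT).1 b.2) hp
  have hsub : ∀ w ∈ p.support, w ∈ upSet T t := fun w hw => (mem_upSet hT).2 ((hsupp w).1 hw).1
  exact ⟨p.induce _ hsub, isPath_induce hp hsub, fun a =>
    (mem_support_induce hsub).trans ((hsupp a).trans (and_iff_right ((mem_upSet hT).1 a.2)))⟩

theorem isTree_subtreeAt (hT : T.graph.IsTree) (t : V) : (subtreeAt T t).graph.IsTree := by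
  refine ⟨?_, hT.isAcyclic.induce _⟩
  rw [SimpleGraph.connected_iff_exists_forall_reachable]
  exact ⟨(subtreeAt T t).root, fun b => (exists_isPath_subtreeAt hT t b).choose.reachable⟩

theorem treeLE_subtreeAt (hT : T.graph.IsTree) {t : V} {a b : upSet T t} :
    treeLE (subtreeAt T t).graph (subtreeAt T t).root a b ↔ treeLE T.graph T.root a b := by
  obtain ⟨p, hp, h⟩ := exists_isPath_subtreeAt hT t b
  exact (treeLE_iff (isTree_subtreeAt hT t) hp).trans (h a)

theorem child_subtreeAt (hT : T.graph.IsTree) {t : V} {a b : upSet T t} :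
    Child (subtreeAt T t).graph (subtreeAt T t).root a b ↔ Child T.graph T.root a b :=
  and_congr Iff.rfl (treeLE_subtreeAt hT)

end Subtree

/-! ### The graph of vertices of all trees of bounded size -/

/-- The rooted trees of size at most `κ`. -/
def Tree (κ : Cardinal.{u}) : Type (u + 1) :=
  {p : RTreeSig.{u} // p.2.graph.IsTree ∧ #p.1 ≤ κ}

variable {κ : Cardinal.{u}}

namespace Tree

/-- The vertices of the tree `p`. -/
abbrev Vert (p : Tree κ) : Type u := p.1.1

/-- The tree-order of `p`. -/
abbrev Le (p : Tree κ) : p.Vert → p.Vert → Prop := treeLE p.1.2.graph p.1.2.root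

/-- The relation between vertices of `p` and their children. -/
abbrev Child (p : Tree κ) : p.Vert → p.Vert → Prop := NashWilliams.Child p.1.2.graph p.1.2.root

/-- The subtree `⌈t⌉` of `p`. -/
def sub (p : Tree κ) (t : p.Vert) : Tree κ :=
  ⟨subtreeSig p.1 t, isTree_subtreeAt p.2.1 t, (mk_set_le _).trans p.2.2⟩

end Tree

/-- The vertices of all rooted trees of size at most `κ`. -/
def Node (κ : Cardinal.{u}) : Type (u + 1) := Σ p : Tree κ, p.Vert

/-- The root of `p`. -/
def Tree.rootNode (p : Tree κ) : Node κ := ⟨p, p.1.2.root⟩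

/-- The children of a vertex in its tree. -/
def children (x : Node κ) : Set (Node κ) := Sigma.mk x.1 '' {c | x.1.Child x.2 c}

theorem mem_children {p : Tree κ} {t c : p.Vert} :
    (⟨p, c⟩ : Node κ) ∈ children ⟨p, t⟩ ↔ p.Child t c :=
  sigma_mk_injective.mem_set_image

theorem mk_children_le (x : Node κ) : #(children x) ≤ Cardinal.lift.{u + 1} κ := by
  have h := mk_image_le_lift (f := Sigma.mk (β := Tree.Vert) x.1) (s := {c | x.1.Child x.2 c})
  have h' := (mk_set_le {c | x.1.Child x.2 c}).trans x.1.2.2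
  rw [Cardinal.lift_id'.{u, u + 1}] at h
  exact h.trans (Cardinal.lift_le.2 h')

theorem reach_children_iff {p : Tree κ} {t : p.Vert} {x : Node κ} :
    Reach children ⟨p, t⟩ x ↔ ∃ s, p.Le t s ∧ x = ⟨p, s⟩ := by
  constructor
  · intro h
    induction h with
    | refl => exact ⟨t, treeLE_refl p.2.1 _ _, rfl⟩
    | tail _ h ih =>
      obtain ⟨s, hs, rfl⟩ := ih
      obtain ⟨c, hc, rfl⟩ := h
      exact ⟨c, treeLE_trans p.2.1 hs hc.2, rfl⟩
  · rintro ⟨s, hs, rfl⟩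
    induction (treeLE_iff_reflTransGen p.2.1).1 hs with
    | refl => exact .refl
    | tail h hc ih => exact (ih ((treeLE_iff_reflTransGen p.2.1).2 h)).tail (mem_children.2 hc)

theorem embLE_of_rel {p q : Tree κ} (R : p.Vert → q.Vert → Prop)
    (hR : ∀ x s, R x s → ∃ s', q.Le s s' ∧ ∃ f : p.Vert → q.Vert, InjOn f {c | p.Child x c} ∧
      ∀ c, p.Child x c → q.Child s' (f c) ∧ R c (f c)) {x : p.Vert} {s : q.Vert} (h : R x s) :
    EmbLE children (⟨p, x⟩ : Node κ) ⟨q, s⟩ := by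
  classical
  refine ⟨fun a b => ∃ x s, R x s ∧ a = ⟨p, x⟩ ∧ b = ⟨q, s⟩, ?_, x, s, h, rfl, rfl⟩
  rintro _ _ ⟨x, s, h, rfl, rfl⟩
  obtain ⟨s', hs, f, hf, hf'⟩ := hR x s h
  refine ⟨⟨q, s'⟩, reach_children_iff.2 ⟨s', hs, rfl⟩,
    fun z => if h : z.1 = p then ⟨q, f (h ▸ z.2)⟩ else z, ?_, ?_⟩
  · rintro _ ⟨c, hc, rfl⟩ _ ⟨c', hc', rfl⟩ e
    simp only [↓reduceDIte] at e
    exact congrArg _ (hf hc hc' (sigma_mk_injective e))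
  · rintro _ ⟨c, hc, rfl⟩
    simp only [↓reduceDIte]
    exact ⟨mem_children.2 (hf' c hc).1, c, f c, (hf' c hc).2, rfl, rfl⟩

theorem EmbLE.exists_child {p q : Tree κ} {x : p.Vert} {s : q.Vert}
    (h : EmbLE children (⟨p, x⟩ : Node κ) ⟨q, s⟩) :
    ∃ s', q.Le s s' ∧ ∃ f : p.Vert → q.Vert, InjOn f {c | p.Child x c} ∧
      ∀ c, p.Child x c → q.Child s' (f c) ∧ EmbLE children (⟨p, c⟩ : Node κ) ⟨q, f c⟩ := by
  obtain ⟨_, hy, ι, hι, hι'⟩ := h.unfold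
  obtain ⟨s', hs, rfl⟩ := reach_children_iff.1 hy
  have : Nonempty q.Vert := ⟨s⟩
  have hd : ∀ c, p.Child x c → ∃ d, q.Child s' d ∧ (⟨q, d⟩ : Node κ) = ι ⟨p, c⟩ :=
    fun c hc => (hι' _ (mem_children.2 hc)).1
  choose! f hf hf' using hd
  refine ⟨s', hs, f, fun c hc c' hc' e => ?_, fun c hc => ⟨hf c hc, ?_⟩⟩
  · exact sigma_mk_injective (hι (mem_children.2 hc) (mem_children.2 hc')
      ((hf' c hc).symm.trans ((congrArg _ e).trans (hf' c' hc'))))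
  · rw [hf' c hc]
    exact (hι' _ (mem_children.2 hc)).2

theorem embLE_rootNode {p q : Tree κ} (h : RTle p.1 q.1) :
    EmbLE children p.rootNode q.rootNode := by
  obtain ⟨e, he⟩ := h
  refine embLE_of_rel (fun x s => q.Le s (e.toFun x)) (fun x s h => ⟨_, h, ?_⟩)
    (treeLE_root q.2.1 _ _)
  exact exists_injOn_child q.2.1 e he x

theorem rtle_of_embLE {p q : Tree κ} (h : EmbLE children p.rootNode q.rootNode) :
    RTle p.1 q.1 := by
  classical
  have : Nonempty q.Vert := ⟨q.1.2.root⟩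
  choose! σ hσ f hf hf' using fun (x : p.Vert) (s : q.Vert)
    (h : EmbLE children (⟨p, x⟩ : Node κ) ⟨q, s⟩) => h.exists_child
  let base : p.Vert → q.Vert := (wellFounded_child p.2.1 p.1.2.root).fix fun c ih =>
    if h : ∃ a, p.Child a c then f h.choose (ih _ h.choose_spec) c else q.1.2.root
  have hb : ∀ c, base c =
      if h : ∃ a, p.Child a c then f h.choose (base h.choose) c else q.1.2.root :=
    fun c => (wellFounded_child p.2.1 p.1.2.root).fix_eq _ c
  have hroot : base p.1.2.root = q.1.2.root := by
    rw [hb, dif_neg]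
    rintro ⟨a, ha⟩
    exact ha.not_le p.2.1 (treeLE_root p.2.1 _ _)
  have hbase : ∀ a c, p.Child a c → base c = f a (base a) c := by
    intro a c h
    have h' : ∃ a, p.Child a c := ⟨a, h⟩
    rw [hb, dif_pos h', h'.choose_spec.parent_unique p.2.1 h]
  have hemb : ∀ x, EmbLE children (⟨p, x⟩ : Node κ) ⟨q, base x⟩ := by
    intro x
    induction (treeLE_iff_reflTransGen p.2.1).1 (treeLE_root p.2.1 p.1.2.root x) with
    | refl => rwa [hroot]
    | tail _ hc ih =>
      rw [hbase _ _ hc]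
      exact (hf' _ _ ih _ hc).2
  refine rootedLE_of_child p.2.1 q.2.1 base (fun x => σ x (base x)) (fun x => hσ x _ (hemb x))
    (fun x c hc => ?_) fun x c hc c' hc' e => ?_
  · rw [hbase x c hc]
    exact (hf' x _ (hemb x) c hc).1
  · rw [hbase x c hc, hbase x c' hc'] at e
    exact hf x _ (hemb x) hc hc' e

theorem embLE_sub (p : Tree κ) (t : p.Vert) :
    EmbLE children (⟨p, t⟩ : Node κ) (p.sub t).rootNode := by
  refine embLE_of_rel (q := p.sub t) (fun x (s : upSet p.1.2 t) => x = s) ?_ rfl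
  rintro _ (s : upSet p.1.2 t) rfl
  have hmem : ∀ c, p.Child s c → c ∈ upSet p.1.2 t := fun c hc => (mem_upSet p.2.1).2
    (treeLE_trans p.2.1 ((mem_upSet p.2.1).1 s.2) hc.2)
  have : Nonempty (upSet p.1.2 t) := ⟨s⟩
  choose! f hf using fun c (h : c ∈ upSet p.1.2 t) =>
    (⟨⟨c, h⟩, rfl⟩ : ∃ d : upSet p.1.2 t, (d : p.Vert) = c)
  refine ⟨s, treeLE_refl (p.sub t).2.1 _ _, f, fun c hc c' hc' e => ?_, fun c hc => ⟨?_, ?_⟩⟩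
  · rw [← hf c (hmem c hc), ← hf c' (hmem c' hc'), e]
  · exact (child_subtreeAt p.2.1).2 ((hf c (hmem c hc)).symm ▸ hc)
  · exact (hf c (hmem c hc)).symm

theorem sub_embLE (p : Tree κ) (t : p.Vert) :
    EmbLE children (p.sub t).rootNode (⟨p, t⟩ : Node κ) := by
  refine embLE_of_rel (p := p.sub t) (fun (x : upSet p.1.2 t) (s : p.Vert) => (x : p.Vert) = s) ?_ rfl
  rintro (x : upSet p.1.2 t) _ rfl
  exact ⟨x.1, treeLE_refl p.2.1 _ _, Subtype.val, Subtype.val_injective.injOn,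
    fun c hc => ⟨(child_subtreeAt p.2.1).1 hc, rfl⟩⟩

/-! ### Nash-Williams ranks -/

theorem hasNWRankAux_iff {α : Ordinal.{u}} {p : RTreeSig.{u}} : HasNWRankAux α p ↔
    (∀ β < α, ¬ HasNWRankAux β p) ∧
      ∀ t : p.1, RTequiv (subtreeSig p t) p ∨ ∃ β < α, HasNWRankAux β (subtreeSig p t) := by
  rw [HasNWRankAux, WellFounded.fix_eq]
  simp only [exists_prop]

/-- `x` is equivalent to the root of a tree of rank `α`. -/
def NodeRank (α : Ordinal.{u}) (x : Node κ) : Prop :=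
  ∃ q : Tree κ, HasNWRankAux α q.1 ∧ EmbLE children q.rootNode x ∧ EmbLE children x q.rootNode

theorem isRanking_nodeRank : IsRanking (children (κ := κ)) NodeRank := by
  rintro α x ⟨q, hq, h1, h2⟩
  refine ⟨q.rootNode, h2, h1, fun y hy => ?_⟩
  obtain ⟨t, -, rfl⟩ := reach_children_iff.1 hy
  rcases (hasNWRankAux_iff.1 hq).2 t with h | ⟨β, hβ, h⟩
  · exact .inl ((embLE_rootNode (q := q.sub t) h.2).trans (sub_embLE q t))
  · exact .inr ⟨β, hβ, q.sub t, h, sub_embLE q t, embLE_sub q t⟩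

end NashWilliams


/-- For every ordinal `α < κ⁺`, the class `𝒯_α` of rooted trees of size at most `κ`
with Nash-Williams rank `α` has at most `κ` equivalence classes under `≡`. -/
theorem card_quot_nwRank_le (κ : Cardinal.{u}) (hκ : Cardinal.aleph0 ≤ κ)
    (α : Ordinal.{u}) (hα : α < (Order.succ κ).ord) :
    Cardinal.mk (Quot fun T S :
        {p : RTreeSig.{u} // p.2.graph.IsTree ∧ Cardinal.mk p.1 ≤ κ ∧ HasNWRankAux α p} =>
      RTequiv T.1 S.1) ≤ Cardinal.lift.{u + 1} κ := by
  have : Infinite κ.out := Cardinal.infinite_iff.2 (by simpa using hκ)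
  have hK : Cardinal.mk (ULift.{u + 1} κ.out) = Cardinal.lift.{u + 1} κ := by simp
  have hα' : α.card ≤ κ := Order.lt_succ_iff.1 (Cardinal.lt_ord.1 hα)
  obtain ⟨c, hc⟩ := NashWilliams.isRanking_nodeRank.few (K := ULift.{u + 1} κ.out)
    (fun x => (NashWilliams.mk_children_le x).trans_eq hK.symm) α (NashWilliams.exists_injOn_Iio (by
      rw [hK, Cardinal.lift_lift]
      exact Cardinal.lift_le.2 hα'))
  let node (T : {p : RTreeSig.{u} // p.2.graph.IsTree ∧ Cardinal.mk p.1 ≤ κ ∧ HasNWRankAux α p}) :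
      NashWilliams.Node κ := NashWilliams.Tree.rootNode ⟨T.1, T.2.1, T.2.2.1⟩
  have hnode : ∀ T, NashWilliams.NodeRank α (node T) := fun T => ⟨_, T.2.2.2, .refl _, .refl _⟩
  rw [← hK]
  refine Cardinal.mk_le_of_injective (f := fun x => c (node x.out)) fun x y h => ?_
  rw [← Quot.out_eq x, ← Quot.out_eq y]
  exact Quot.sound ⟨NashWilliams.rtle_of_embLE (hc _ (hnode _) _ (hnode _) h),
    NashWilliams.rtle_of_embLE (hc _ (hnode _) _ (hnode _) h.symm)⟩
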